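/- arXiv:1909.03440 — 9 statements merged into one kernel-verified Lean document; each statement's English description precedes it below -/
import Mathlib

section
/- Let R be a commutative Noetherian ring. The following are equivalent: (a) any pair of extending R-modules that are subisomorphic to each other are isomorphic; (b) for every prime ideal P of R, any pair of extending R-modules, each having {P} as its set of associated primes, that are subisomorphic to each other are isomorphic. -/
universe u v

section Defs

variable (R : Type u) [Ring R]

/-- A submodule `N` of `M` is a direct summand of `M`. -/
def IsDirectSummand {M : Type v} [AddCommGroup M] [Module R M] (N : Submodule R M) : Prop :=
  ∃ N' : Submodule R M, IsCompl N N'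

/-- `N` is isomorphic (as an `R`-module) to a direct summand of `K`. -/
def IsoToDirectSummand (N : Type*) [AddCommGroup N] [Module R N]
    (K : Type*) [AddCommGroup K] [Module R K] : Prop :=
  ∃ L : Submodule R K, IsDirectSummand R L ∧ Nonempty (N ≃ₗ[R] L)

/-- `N` and `K` are d-subisomorphic to each other. -/
def DSubisomorphic (N : Type*) [AddCommGroup N] [Module R N]
    (K : Type*) [AddCommGroup K] [Module R K] : Prop :=
  IsoToDirectSummand R N K ∧ IsoToDirectSummand R K N

/-- `N` and `K` are subisomorphic to each other: each embeds in the other. -/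
def Subisomorphic (N : Type*) [AddCommGroup N] [Module R N]
    (K : Type*) [AddCommGroup K] [Module R K] : Prop :=
  (∃ f : N →ₗ[R] K, Function.Injective f) ∧ (∃ g : K →ₗ[R] N, Function.Injective g)

/-- A module is Rickart if kernels of endomorphisms are direct summands. -/
def IsRickartModule (M : Type v) [AddCommGroup M] [Module R M] : Prop :=
  ∀ f : Module.End R M, IsDirectSummand R (LinearMap.ker f)

/-- A module is Baer if for every submodule `N`, the annihilator of `N` in the
endomorphism ring `S` is generated, as a left ideal of `S`, by an idempotent. -/
def IsBaerModule (M : Type v) [AddCommGroup M] [Module R M] : Prop :=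
  ∀ N : Submodule R M, ∃ e : Module.End R M, IsIdempotentElem e ∧
    ∀ f : Module.End R M, (∀ x ∈ N, f x = 0) ↔ ∃ g : Module.End R M, f = g * e

/-- A module is dual Rickart if images of endomorphisms are direct summands. -/
def IsDualRickartModule (M : Type v) [AddCommGroup M] [Module R M] : Prop :=
  ∀ f : Module.End R M, IsDirectSummand R (LinearMap.range f)

/-- A module is dual Baer if for every submodule `N`, the set of endomorphisms with
image contained in `N` is generated, as a right ideal of the endomorphism ring, by
an idempotent. -/
def IsDualBaerModule (M : Type v) [AddCommGroup M] [Module R M] : Prop :=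
  ∀ N : Submodule R M, ∃ e : Module.End R M, IsIdempotentElem e ∧
    ∀ f : Module.End R M, (LinearMap.range f ≤ N) ↔ ∃ g : Module.End R M, f = e * g

/-- `M` satisfies the Schröder–Bernstein (SB) property: d-subisomorphic direct summands
of `M` are isomorphic. -/
def SatisfiesSB (M : Type v) [AddCommGroup M] [Module R M] : Prop :=
  ∀ A B : Submodule R M, IsDirectSummand R A → IsDirectSummand R B →
    DSubisomorphic R A B → Nonempty (A ≃ₗ[R] B)

/-- `N` is an essential submodule of `D` (inside the ambient module `M`). -/
def IsEssentialIn {M : Type v} [AddCommGroup M] [Module R M] (N D : Submodule R M) : Prop :=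
  N ≤ D ∧ ∀ L : Submodule R M, L ≤ D → L ⊓ N = ⊥ → L = ⊥

/-- A module is extending if every submodule is essential in a direct summand. -/
def IsExtendingModule (M : Type v) [AddCommGroup M] [Module R M] : Prop :=
  ∀ N : Submodule R M, ∃ D : Submodule R M, IsDirectSummand R D ∧ IsEssentialIn R N D

/-- An ideal of `R` is essential if it intersects every nonzero ideal nontrivially. -/
def IsEssentialIdeal (I : Submodule R R) : Prop :=
  ∀ J : Submodule R R, J ⊓ I = ⊥ → J = ⊥

/-- The annihilator of an element of a module, as an ideal of `R`. -/
def annihilatorOf {M : Type v} [AddCommGroup M] [Module R M] (m : M) : Submodule R R :=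
  LinearMap.ker (LinearMap.toSpanSingleton R M m)

/-- An element is singular if its annihilator is an essential ideal. -/
def IsSingularElem {M : Type v} [AddCommGroup M] [Module R M] (m : M) : Prop :=
  IsEssentialIdeal R (annihilatorOf R m)

/-- A module is singular if all of its elements are singular, i.e. `Z(M) = M`. -/
def IsSingularModule (M : Type v) [AddCommGroup M] [Module R M] : Prop :=
  ∀ m : M, IsSingularElem R m

/-- A module is nonsingular if only zero is singular, i.e. `Z(M) = 0`. -/
def IsNonsingularModule (M : Type v) [AddCommGroup M] [Module R M] : Prop :=
  ∀ m : M, IsSingularElem R m → m = 0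

/-- A subset of `R` is essential if it meets every nonzero ideal nontrivially. -/
def IsEssentialSet (A : Set R) : Prop :=
  ∀ J : Submodule R R, J ≠ ⊥ → ∃ x ∈ J, x ≠ 0 ∧ x ∈ A

/-- `m` belongs to the second singular submodule `Z₂(M)`: the annihilator of the image
of `m` in `M/Z(M)` is essential. -/
def IsZ2Elem {M : Type v} [AddCommGroup M] [Module R M] (m : M) : Prop :=
  IsEssentialSet R {r : R | IsSingularElem R (r • m)}

/-- The second singular ideal `Z₂(R)` of `R`, as a two-sided ideal. -/
def secondSingularIdeal : TwoSidedIdeal R :=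
  TwoSidedIdeal.span {r : R | IsZ2Elem R r}

/-- The quotient ring `R / Z₂(R)`. -/
def QuotBySecondSingular : Type u := (secondSingularIdeal R).ringCon.Quotient

noncomputable instance : Ring (QuotBySecondSingular R) :=
  inferInstanceAs (Ring (secondSingularIdeal R).ringCon.Quotient)

/-- `M` has finite uniform dimension: it contains no infinite direct sum of nonzero
submodules. -/
def HasFiniteUniformDim (M : Type v) [AddCommGroup M] [Module R M] : Prop :=
  ¬ ∃ f : ℕ → Submodule R M, (∀ n, f n ≠ ⊥) ∧ iSupIndep f

end Defs

set_option linter.unusedSectionVars false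

namespace ExtSB
open Submodule

variable {R : Type u} [CommRing R] [IsNoetherianRing R]

theorem mem_ass {M : Type v} [AddCommGroup M] [Module R M] {P : Ideal R} :
    P ∈ associatedPrimes R M ↔ P.IsPrime ∧ ∃ m : M, ∀ r, r ∈ P ↔ r • m = 0 := by
  rw [AssociatedPrimes.mem_iff, isAssociatedPrime_iff]
  refine and_congr_right fun _ => exists_congr fun m => ?_
  rw [Ideal.ext_iff]
  simp [Submodule.mem_colon_singleton]

/-- Component of an element with prime annihilator. -/
theorem exists_comp {ι : Type*} {B : ι → Type*} [∀ i, AddCommGroup (B i)] [∀ i, Module R (B i)]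
    (y : Π₀ i, B i) (P : Ideal R) (hP : P.IsPrime) (hy : ∀ r, r ∈ P ↔ r • y = 0) :
    ∃ i, ∀ r, r ∈ P ↔ r • y i = 0 := by
  classical
  have h1 : y.support.inf (fun i => LinearMap.ker (LinearMap.toSpanSingleton R (B i) (y i))) ≤ P := by
    intro r hr
    rw [hy]
    ext i
    rw [Submodule.mem_finsetInf] at hr
    by_cases hi : i ∈ y.support
    · simpa using hr i hi
    · have : y i = 0 := by simpa using hi
      simp [this]
  obtain ⟨i, -, hi⟩ := (Ideal.IsPrime.inf_le' hP).1 h1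
  refine ⟨i, fun r => ⟨fun hr => ?_, fun hr => hi (by simpa using hr)⟩⟩
  have := (hy r).1 hr
  simpa using DFunLike.congr_fun this i

theorem ann_smul {M : Type v} [AddCommGroup M] [Module R M] {P : Ideal R} (hP : P.IsPrime) {m : M}
    (hm : ∀ r, r ∈ P ↔ r • m = 0) {s : R} (hs : s • m ≠ 0) : ∀ r, r ∈ P ↔ r • s • m = 0 := by
  intro r
  rw [smul_smul, ← hm]
  rw [Ne, ← hm] at hs
  exact ⟨fun h => P.mul_mem_right _ h, fun h => (hP.mem_or_mem h).resolve_right hs⟩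

/-- Every nonzero module element has a multiple with prime annihilator. -/
theorem exists_prime_smul {M : Type v} [AddCommGroup M] [Module R M] (x : M) (hx : x ≠ 0) :
    ∃ (P : Ideal R) (s : R), P.IsPrime ∧ ∀ r, r ∈ P ↔ r • s • x = 0 := by
  obtain ⟨P, hP, -⟩ := exists_le_isAssociatedPrime_of_isNoetherianRing R
    (⟨x, mem_span_singleton_self x⟩ : span R {x}) (by simpa using hx)
  obtain ⟨hp, ⟨m, hm⟩, h⟩ := mem_ass.1 hP
  obtain ⟨s, rfl⟩ := mem_span_singleton.1 hm
  exact ⟨P, s, hp, fun r => by rw [h r]; simp [Subtype.ext_iff]⟩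

theorem summand_of_le {M : Type v} [AddCommGroup M] [Module R M] {T A : Submodule R M}
    (hT : IsDirectSummand R T) (h : T ≤ A) : ∃ T', T' ≤ A ∧ T ⊔ T' = A ∧ Disjoint T T' := by
  obtain ⟨T₀, hT₀⟩ := hT
  refine ⟨T₀ ⊓ A, inf_le_right, ?_, hT₀.disjoint.mono_right inf_le_left⟩
  rw [← sup_inf_assoc_of_le _ h, hT₀.sup_eq_top, top_inf_eq]

theorem summand_sup {M : Type v} [AddCommGroup M] [Module R M] {T U A B : Submodule R M}
    (hT : IsDirectSummand R T) (hU : IsDirectSummand R U) (hTA : T ≤ A) (hUB : U ≤ B)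
    (hAB : IsCompl A B) : IsDirectSummand R (T ⊔ U) := by
  obtain ⟨T', hT', h1, h2⟩ := summand_of_le hT hTA
  obtain ⟨U', hU', h3, h4⟩ := summand_of_le hU hUB
  refine ⟨T' ⊔ U', ?_, ?_⟩
  · rw [Submodule.disjoint_def]
    intro x hx hx'
    obtain ⟨t, ht, u, hu, rfl⟩ := mem_sup.1 hx
    obtain ⟨t', ht', u', hu', e⟩ := mem_sup.1 hx'
    have e2 : t - t' = u' - u := by rw [sub_eq_sub_iff_add_eq_add, ← e]; abel
    have e3 : t - t' = 0 := by
      refine Submodule.disjoint_def.1 hAB.disjoint _ (sub_mem (hTA ht) (hT' ht')) ?_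
      rw [e2]; exact sub_mem (hU' hu') (hUB hu)
    have e4 : u' = u := by rw [e3] at e2; exact (sub_eq_zero.1 e2.symm)
    have e5 := sub_eq_zero.1 e3
    subst e4 e5
    rw [Submodule.disjoint_def.1 h2 _ ht ht', Submodule.disjoint_def.1 h4 _ hu hu', add_zero]
  · rw [codisjoint_iff, sup_sup_sup_comm, h1, h3, hAB.sup_eq_top]

/-- Relative extending property of a direct summand `D`, inside the ambient module. -/
theorem extending_rel {M : Type v} [AddCommGroup M] [Module R M] (hM : IsExtendingModule R M)
    {D D' : Submodule R M} (hD : IsCompl D D') (N : Submodule R M) (hN : N ≤ D) :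
    ∃ U, U ≤ D ∧ IsDirectSummand R U ∧ IsEssentialIn R N U := by
  obtain ⟨E, ⟨E', hE⟩, hNE, hess⟩ := hM (N ⊔ D')
  have hD'E : D' ≤ E := le_sup_right.trans hNE
  have hsup : D' ⊔ (E ⊓ D) = E := by
    rw [inf_comm, ← sup_inf_assoc_of_le _ hD'E, hD.symm.sup_eq_top, top_inf_eq]
  refine ⟨E ⊓ D, inf_le_right, ⟨D' ⊔ E', ?_⟩, le_inf (le_sup_left.trans hNE) hN, ?_⟩
  · have h1 : Disjoint (E ⊓ D) D' := hD.disjoint.mono_left inf_le_right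
    refine ⟨h1.disjoint_sup_right_of_disjoint_sup_left ?_, ?_⟩
    · rw [sup_comm, hsup]; exact hE.disjoint
    · rw [codisjoint_iff, ← sup_assoc, sup_comm (E ⊓ D), hsup, hE.sup_eq_top]
  · intro L hL hLN
    refine hess L (hL.trans inf_le_left) ?_
    rw [eq_bot_iff]
    rintro l ⟨hl, hl'⟩
    obtain ⟨n, hn, d, hd, e⟩ := mem_sup.1 hl'
    have hd0 : d = 0 := by
      refine Submodule.disjoint_def.1 hD.disjoint _ ?_ hd
      have : d = l - n := by rw [← e]; abel
      rw [this]; exact sub_mem (hL hl).2 (hN hn)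
    rw [hd0, add_zero] at e
    subst e
    rw [← hLN]; exact ⟨hl, hn⟩

theorem extending_summand {M : Type v} [AddCommGroup M] [Module R M] (hM : IsExtendingModule R M)
    {D : Submodule R M} (hD : IsDirectSummand R D) : IsExtendingModule R D := by
  obtain ⟨D', hD⟩ := hD
  intro N
  obtain ⟨U, hUD, hU, hNU, hess⟩ := extending_rel hM hD (N.map D.subtype) (map_subtype_le _ _)
  obtain ⟨U', hU', h1, h2⟩ := summand_of_le hU hUD
  refine ⟨U.comap D.subtype, ⟨U'.comap D.subtype, ?_, ?_⟩, map_le_iff_le_comap.1 hNU, ?_⟩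
  · rw [Submodule.disjoint_def] at h2 ⊢
    intro x hx hx'
    exact Subtype.ext (h2 _ hx hx')
  · rw [codisjoint_iff, eq_top_iff]
    rintro ⟨x, hx⟩ -
    rw [← h1] at hx
    obtain ⟨a, ha, b, hb, rfl⟩ := mem_sup.1 hx
    exact mem_sup.2 ⟨⟨a, hUD ha⟩, ha, ⟨b, hU' hb⟩, hb, rfl⟩
  · intro L hL hLN
    have := hess (L.map D.subtype) (map_le_iff_le_comap.2 hL) (by
      rw [← map_inf _ D.injective_subtype, hLN, Submodule.map_bot])
    exact Submodule.map_injective_of_injective D.injective_subtype (this.trans (Submodule.map_bot _).symm)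

/-- Okado: over a noetherian ring, a local direct summand is closed, hence a summand. -/
theorem local_summand {M : Type v} [AddCommGroup M] [Module R M] (hM : IsExtendingModule R M)
    (S : Set (Submodule R M))
    (hS : ∀ F : Finset (Submodule R M), (F : Set (Submodule R M)) ⊆ S →
      IsDirectSummand R (sSup (F : Set (Submodule R M)))) :
    IsDirectSummand R (sSup S) := by
  obtain ⟨D, hD, hAD, hess⟩ := hM (sSup S)
  suffices h : D ≤ sSup S by rwa [le_antisymm hAD h]
  by_contra hcon
  obtain ⟨x₀, hx₀, hx₀'⟩ := SetLike.not_le_iff_exists.1 hcon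
  obtain ⟨I, ⟨x, hx, hxA, rfl⟩, hmax⟩ := set_has_maximal_iff_noetherian.mpr
    (inferInstance : IsNoetherian R R)
    {I | ∃ x ∈ D, x ∉ sSup S ∧ I = LinearMap.ker (LinearMap.toSpanSingleton R M x)}
    ⟨_, x₀, hx₀, hx₀', rfl⟩
  have hx0 : x ≠ 0 := fun h => hxA (h ▸ zero_mem _)
  have : span R {x} ⊓ sSup S ≠ ⊥ := fun h => hx0 <| by
    simpa using hess _ (by simpa using hx) h
  obtain ⟨y, ⟨hy, hyA⟩, hy0⟩ := Submodule.exists_mem_ne_zero_of_ne_bot this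
  obtain ⟨r, rfl⟩ := mem_span_singleton.1 hy
  obtain ⟨F, hF, hrF⟩ := Submodule.mem_sSup_iff_exists_finset.1 hyA
  replace hrF : r • x ∈ sSup (F : Set (Submodule R M)) := by
    rw [sSup_eq_iSup]; exact hrF
  have hFA : sSup (F : Set (Submodule R M)) ≤ sSup S := sSup_le_sSup hF
  obtain ⟨B, hB⟩ := hS F hF
  have hxt : x ∈ sSup (F : Set (Submodule R M)) ⊔ B := by rw [hB.sup_eq_top]; trivial
  obtain ⟨a, ha, b, hb, rfl⟩ := mem_sup.1 hxt
  have hdis := Submodule.disjoint_def.1 hB.disjoint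
  refine hmax (LinearMap.ker (LinearMap.toSpanSingleton R M b)) ⟨b, ?_, ?_, rfl⟩ ?_
  · simpa using sub_mem hx (hAD (hFA ha))
  · exact fun h => hxA (add_mem (hFA ha) h)
  · refine lt_of_le_of_ne ?_ ?_
    · intro s hs
      simp only [LinearMap.mem_ker, LinearMap.toSpanSingleton_apply, smul_add] at hs ⊢
      refine hdis _ ?_ (B.smul_mem s hb)
      rw [eq_neg_of_add_eq_zero_right hs]
      exact neg_mem (smul_mem _ s ha)
    · intro heq
      apply hy0
      have : r ∈ LinearMap.ker (LinearMap.toSpanSingleton R M b) := by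
        simp only [LinearMap.mem_ker, LinearMap.toSpanSingleton_apply]
        refine hdis _ ?_ (B.smul_mem r hb)
        have : r • b = r • (a + b) - r • a := by rw [smul_add]; abel
        rw [this]
        exact sub_mem hrF (smul_mem _ r ha)
      rw [← heq] at this
      simpa using this

/-- Decomposition into submodules with exactly one associated prime. -/
theorem exists_family {M : Type v} [AddCommGroup M] [Module R M] (hM : IsExtendingModule R M) :
    ∃ S : Set (Submodule R M), sSupIndep S ∧ sSup S = ⊤ ∧
      ∀ U ∈ S, ∃ P, associatedPrimes R U = {P} := by
  obtain ⟨S, hS⟩ := zorn_subset {S : Set (Submodule R M) | sSupIndep S ∧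
      (∀ U ∈ S, ∃ P, associatedPrimes R U = {P}) ∧
      ∀ F : Finset (Submodule R M), (F : Set (Submodule R M)) ⊆ S →
      IsDirectSummand R (sSup (F : Set (Submodule R M)))} (by
    intro c hc hchain
    rcases c.eq_empty_or_nonempty with rfl | hne
    · refine ⟨∅, ⟨sSupIndep_empty, by simp, ?_⟩, by simp⟩
      intro F hF
      have : (F : Set (Submodule R M)) = ∅ := Set.subset_empty_iff.1 hF
      rw [this, sSup_empty]
      exact ⟨⊤, isCompl_bot_top⟩
    refine ⟨⋃₀ c, ⟨iSupIndep_sUnion_of_directed hchain.directedOn fun s hs => (hc hs).1, ?_, ?_⟩,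
      fun s hs => Set.subset_sUnion_of_mem hs⟩
    · rintro U ⟨s, hs, hU⟩
      exact (hc hs).2.1 U hU
    · intro F hF
      obtain ⟨s, hs, hFs⟩ := DirectedOn.exists_mem_subset_of_finset_subset_biUnion (f := id) hne
        (by simpa using hchain.directedOn) (s := F) (by simpa [Set.sUnion_eq_biUnion] using hF)
      exact (hc hs).2.2 F hFs)
  obtain ⟨hind, hass, hloc⟩ := hS.prop
  refine ⟨S, hind, ?_, hass⟩
  obtain ⟨B, hB⟩ := local_summand hM S hloc
  by_cases hB0 : B = ⊥
  · subst hB0; simpa using hB.sup_eq_top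
  exfalso
  obtain ⟨x₀, hx₀, hx₀0⟩ := Submodule.exists_mem_ne_zero_of_ne_bot hB0
  obtain ⟨P, s, hP, hx⟩ := exists_prime_smul (R := R) x₀ hx₀0
  generalize hxx : s • x₀ = x at hx
  have hxB : x ∈ B := hxx ▸ B.smul_mem s hx₀
  obtain ⟨U, hUB, hU, hxU, hess⟩ := extending_rel hM hB.symm (span R {x}) (by simpa using hxB)
  have hxU : x ∈ U := by simpa using hxU
  have hx0 : x ≠ 0 := by
    rintro rfl
    exact hP.ne_top ((Ideal.eq_top_iff_one _).2 ((hx 1).2 (by simp)))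
  have hUass : associatedPrimes R U = {P} := by
    refine Set.eq_singleton_iff_unique_mem.2 ⟨mem_ass.2 ⟨hP, ⟨x, hxU⟩, fun r => ?_⟩, ?_⟩
    · rw [hx]; simp [Subtype.ext_iff]
    · intro Q hQ
      obtain ⟨hQp, ⟨y, hyU⟩, hy⟩ := mem_ass.1 hQ
      have hy : ∀ r, r ∈ Q ↔ r • y = 0 := fun r => by rw [hy]; simp [Subtype.ext_iff]
      have hy0 : y ≠ 0 := by
        rintro rfl
        exact hQp.ne_top ((Ideal.eq_top_iff_one _).2 ((hy 1).2 (by simp)))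
      have : span R {y} ⊓ span R {x} ≠ ⊥ := fun h => hy0 <| by
        simpa using hess _ (by simpa using hyU) h
      obtain ⟨z, ⟨hz1, hz2⟩, hz0⟩ := Submodule.exists_mem_ne_zero_of_ne_bot this
      obtain ⟨a, rfl⟩ := mem_span_singleton.1 hz1
      obtain ⟨b, hb⟩ := mem_span_singleton.1 hz2
      ext r
      rw [ann_smul hQp hy hz0 r, ← hb, ← ann_smul hP hx (by rwa [hb]) r]
  have hUdisj : Disjoint (sSup S) U := hB.disjoint.mono_right hUB
  have hUS : U ∉ S := fun h => by
    have h1 : U = ⊥ := by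
      have := hUdisj.symm.eq_bot_of_le (le_sSup h)
      exact this
    rw [h1] at hxU
    exact hx0 (by simpa using hxU)
  apply hUS
  refine hS.le_of_ge (y := insert U S) ⟨?_, ?_, ?_⟩ (Set.subset_insert _ _) (Set.mem_insert _ _)
  · intro V hV
    by_cases hVU : V = U
    · subst hVU
      refine hUdisj.symm.mono_right (sSup_le_sSup ?_)
      rintro W ⟨hW1, hW2⟩
      exact hW1.resolve_left hW2
    · have hVS : V ∈ S := hV.resolve_left hVU
      have h1 := hind hVS
      refine (h1.disjoint_sup_right_of_disjoint_sup_left (c := U) ?_).mono_right ?_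
      · exact hUdisj.mono_left (sup_le (le_sSup hVS) (sSup_le_sSup Set.sdiff_subset))
      · refine sSup_le ?_
        rintro W ⟨rfl | hW1, hW2⟩
        · exact le_sup_right
        · have hW : W ∈ S \ {V} := ⟨hW1, hW2⟩
          exact (le_sSup hW).trans le_sup_left
  · rintro V (rfl | hV)
    · exact ⟨P, hUass⟩
    · exact hass V hV
  · classical
    intro F hF
    have hF' : ((F.erase U : Finset _) : Set (Submodule R M)) ⊆ S := by
      intro W hW
      have hW' := Finset.mem_erase.1 (Finset.mem_coe.1 hW)
      exact (hF hW'.2).resolve_left hW'.1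
    by_cases hUF : U ∈ F
    · have e : sSup (F : Set (Submodule R M)) =
          sSup ((F.erase U : Finset _) : Set (Submodule R M)) ⊔ U := by
        conv_lhs => rw [← Finset.insert_erase hUF]
        rw [Finset.coe_insert, sSup_insert, sup_comm]
      rw [e]
      exact summand_sup (hloc _ hF') hU (sSup_le_sSup hF') hUB hB
    · rw [Finset.erase_eq_of_notMem hUF] at hF'
      exact hloc F hF'

theorem exists_decomp {M : Type v} [AddCommGroup M] [Module R M] (hM : IsExtendingModule R M) :
    ∃ A : Ideal R → Submodule R M, iSupIndep A ∧ ⨆ P, A P = ⊤ ∧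
      (∀ P, associatedPrimes R (A P) ⊆ {P}) ∧ ∀ P, IsExtendingModule R (A P) := by
  classical
  obtain ⟨S, hind, htop, hass⟩ := exists_family hM
  have hA : iSupIndep (fun P : Ideal R => sSup {U ∈ S | associatedPrimes R U = {P}}) := by
    intro P
    have h1 := ((sSupIndep_iff S).1 hind).disjoint_biSup_biSup
      (s := {U : S | associatedPrimes R U = {P}}) (t := {U : S | associatedPrimes R U ≠ {P}})
      (by rw [Set.disjoint_left]; intro U h h'; exact h' h)
    refine h1.mono ?_ ?_
    · refine sSup_le ?_
      rintro U ⟨hU, hUP⟩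
      exact le_biSup (fun U : S => (U : Submodule R M)) (i := ⟨U, hU⟩) hUP
    · refine iSup₂_le fun Q hQ => sSup_le ?_
      rintro U ⟨hU, hUP⟩
      refine le_biSup (fun U : S => (U : Submodule R M)) (i := ⟨U, hU⟩) ?_
      intro h
      exact hQ (Set.singleton_injective (hUP.symm.trans h))
  have hAtop : ⨆ P : Ideal R, sSup {U ∈ S | associatedPrimes R U = {P}} = ⊤ := by
    rw [eq_top_iff, ← htop]
    refine sSup_le fun U hU => ?_
    obtain ⟨P, hP⟩ := hass U hU
    exact le_iSup_of_le P (le_sSup ⟨hU, hP⟩)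
  refine ⟨_, hA, hAtop, ?_, ?_⟩
  · intro P Q hQ
    obtain ⟨hQp, ⟨x, hx⟩, h⟩ := mem_ass.1 hQ
    have h : ∀ r, r ∈ Q ↔ r • x = 0 := fun r => by rw [h]; simp [Subtype.ext_iff]
    have hind' := (sSupIndep_iff _).1
      (hind.mono (Set.sep_subset S fun U => associatedPrimes R U = {P}))
    rw [sSup_eq_iSup'] at hx
    obtain ⟨f, rfl⟩ := (Submodule.mem_iSup_iff_exists_dfinsupp _ _).1 hx
    have hinj := hind'.dfinsupp_lsum_injective
    obtain ⟨U, hU⟩ := exists_comp f Q hQp (fun r => by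
      rw [h, ← map_smul]
      exact map_eq_zero_iff _ hinj)
    have : Q ∈ associatedPrimes R U.1 := mem_ass.2 ⟨hQp, f U, hU⟩
    rwa [U.2.2] at this
  · intro P
    refine extending_summand hM ⟨_, hA P, ?_⟩
    rw [codisjoint_iff, eq_top_iff, ← hAtop]
    refine iSup_le fun Q => ?_
    by_cases hQ : Q = P
    · subst hQ; exact le_sup_left
    · exact le_sup_of_le_right (le_iSup₂_of_le Q hQ le_rfl)

/-- Embeddings restrict to the components. -/
theorem comp_embed {X : Type u} [AddCommGroup X] [Module R X]
    {B : Ideal R → Type v} [∀ i, AddCommGroup (B i)] [∀ i, Module R (B i)]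
    (hB : ∀ P, associatedPrimes R (B P) ⊆ {P}) (P : Ideal R)
    (hX : associatedPrimes R X ⊆ {P}) (f : X →ₗ[R] Π₀ P, B P) (hf : Function.Injective f) :
    Function.Injective ((DFinsupp.lapply P : (Π₀ P, B P) →ₗ[R] B P) ∘ₗ f) := by
  rw [injective_iff_map_eq_zero]
  intro x hx
  by_contra hx0
  obtain ⟨Q, s, hQ, h⟩ := exists_prime_smul (R := R) x hx0
  have hQP : Q = P := hX (mem_ass.2 ⟨hQ, s • x, h⟩)
  subst hQP
  obtain ⟨i, hi⟩ := exists_comp (f (s • x)) Q hQ (fun r => by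
    rw [h, ← map_smul]; exact (map_eq_zero_iff _ hf).symm)
  have hQi : Q = i := hB i (mem_ass.2 ⟨hQ, _, hi⟩)
  subst hQi
  have h0 : f (s • x) Q = 0 := by
    have : f x Q = 0 := hx
    rw [map_smul, DFinsupp.smul_apply, this, smul_zero]
  exact hQ.ne_top ((Ideal.eq_top_iff_one _).2 ((hi 1).2 (by rw [h0, smul_zero])))

theorem ass_empty_subsingleton {M : Type v} [AddCommGroup M] [Module R M]
    (h : associatedPrimes R M = ∅) : Subsingleton M := by
  by_contra hn
  rw [not_subsingleton_iff_nontrivial] at hn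
  obtain ⟨x, hx⟩ := exists_ne (0 : M)
  obtain ⟨P, s, hP, hh⟩ := exists_prime_smul (R := R) x hx
  have : P ∈ associatedPrimes R M := mem_ass.2 ⟨hP, _, hh⟩
  rw [h] at this
  exact this

end ExtSB

/-- Over a commutative Noetherian ring `R`, any pair of mutually
subisomorphic extending `R`-modules are isomorphic iff for every prime ideal `P`,
any pair of mutually subisomorphic extending `R`-modules whose set of associated
primes is `{P}` are isomorphic. -/
theorem extending_SB_iff_associated_prime_SB
    (R : Type u) [CommRing R] [IsNoetherianRing R] :
    (∀ (X : Type u) [AddCommGroup X] [Module R X]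
      (Y : Type u) [AddCommGroup Y] [Module R Y],
      IsExtendingModule R X → IsExtendingModule R Y →
      Subisomorphic R X Y → Nonempty (X ≃ₗ[R] Y)) ↔
    (∀ P : Ideal R, P.IsPrime →
      ∀ (X : Type u) [AddCommGroup X] [Module R X]
        (Y : Type u) [AddCommGroup Y] [Module R Y],
        IsExtendingModule R X → IsExtendingModule R Y →
        associatedPrimes R X = {P} → associatedPrimes R Y = {P} →
        Subisomorphic R X Y → Nonempty (X ≃ₗ[R] Y)) := by
  classical
  refine ⟨fun h P _ X _ _ Y _ _ hX hY _ _ hXY => h X Y hX hY hXY, ?_⟩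
  intro H X _ _ Y _ _ hX hY hXY
  obtain ⟨⟨f, hf⟩, ⟨g, hg⟩⟩ := hXY
  obtain ⟨A, hAi, hAt, hAass, hAext⟩ := ExtSB.exists_decomp hX
  obtain ⟨B, hBi, hBt, hBass, hBext⟩ := ExtSB.exists_decomp hY
  let eA := hAi.linearEquiv hAt
  let eB := hBi.linearEquiv hBt
  have key : ∀ P, Nonempty (A P ≃ₗ[R] B P) := by
    intro P
    have hF := ExtSB.comp_embed (B := fun P => B P) hBass P (hAass P)
      (eB.symm.toLinearMap ∘ₗ f ∘ₗ (A P).subtype)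
      (eB.symm.injective.comp (hf.comp (A P).injective_subtype))
    have hG := ExtSB.comp_embed (B := fun P => A P) hAass P (hBass P)
      (eA.symm.toLinearMap ∘ₗ g ∘ₗ (B P).subtype)
      (eA.symm.injective.comp (hg.comp (B P).injective_subtype))
    by_cases hA0 : associatedPrimes R (A P) = ∅
    · have := ExtSB.ass_empty_subsingleton hA0
      have := hG.subsingleton
      exact ⟨LinearEquiv.ofBijective 0 ⟨fun _ _ _ => Subsingleton.elim _ _,
        fun y => ⟨0, Subsingleton.elim _ _⟩⟩⟩
    · have hA1 := (Set.subset_singleton_iff_eq.1 (hAass P)).resolve_left hA0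
      have hB1 : associatedPrimes R (B P) = {P} := by
        refine (hBass P).antisymm ?_
        rw [← hA1]
        exact associatedPrimes.subset_of_injective hF
      have hP : P.IsPrime := by
        have : P ∈ associatedPrimes R (A P) := by rw [hA1]; rfl
        exact this.isPrime
      exact H P hP (A P) (B P) (hAext P) (hBext P) hA1 hB1 ⟨⟨_, hF⟩, ⟨_, hG⟩⟩
  exact ⟨eA.symm ≪≫ₗ DFinsupp.mapRange.linearEquiv (fun P => (key P).some) ≪≫ₗ eB⟩
end

section
/- Let R be a commutative domain. The following are equivalent: (a) any pair of extending R-modules that are subisomorphic to each other are isomorphic; (b) any pair of torsion-free extending R-modules that are subisomorphic to each other are isomorphic; (c) R is a field. -/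
universe u v

/-- A module over a commutative domain is torsion-free. -/
def IsTorsionFreeModule (R : Type u) [Ring R] (M : Type v) [AddCommGroup M]
    [Module R M] : Prop :=
  ∀ (r : R) (m : M), r • m = 0 → r = 0 ∨ m = 0

section Helpers

variable {R : Type u} [CommRing R] [IsDomain R]

/-- The closure (purification) of a submodule over a domain. -/
def pureClosure {M : Type v} [AddCommGroup M] [Module R M] (N : Submodule R M) :
    Submodule R M where
  carrier := {m | ∃ r : R, r ≠ 0 ∧ r • m ∈ N}
  zero_mem' := ⟨1, one_ne_zero, by simp⟩
  add_mem' := by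
    rintro a b ⟨r, hr, ha⟩ ⟨s, hs, hb⟩
    refine ⟨r * s, mul_ne_zero hr hs, ?_⟩
    rw [smul_add]
    refine N.add_mem ?_ ?_
    · rw [mul_comm, mul_smul]; exact N.smul_mem _ ha
    · rw [mul_smul]; exact N.smul_mem _ hb
  smul_mem' := by
    rintro c m ⟨r, hr, hm⟩
    refine ⟨r, hr, ?_⟩
    rw [smul_comm]; exact N.smul_mem _ hm

lemma pureClosure_closed {M : Type v} [AddCommGroup M] [Module R M] (N : Submodule R M)
    (r : R) (hr : r ≠ 0) (m : M) (h : r • m ∈ pureClosure N) : m ∈ pureClosure N := by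
  obtain ⟨s, hs, h⟩ := h
  exact ⟨s * r, mul_ne_zero hs hr, by rwa [mul_smul]⟩

lemma pureClosure_essential {M : Type v} [AddCommGroup M] [Module R M]
    (hM : IsTorsionFreeModule R M) (N : Submodule R M) :
    IsEssentialIn R N (pureClosure N) := by
  refine ⟨fun x hx => ⟨1, one_ne_zero, by simpa using hx⟩, fun L hL h => ?_⟩
  rw [eq_bot_iff]
  intro x hx
  obtain ⟨r, hr, h2⟩ := hL hx
  have h3 : r • x ∈ L ⊓ N := ⟨L.smul_mem _ hx, h2⟩
  rw [h, Submodule.mem_bot] at h3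
  rcases hM _ _ h3 with h4 | h4
  · exact absurd h4 hr
  · simpa using h4

lemma extending_of_closed {M : Type v} [AddCommGroup M] [Module R M]
    (hM : IsTorsionFreeModule R M)
    (h : ∀ D : Submodule R M, (∀ (r : R), r ≠ 0 → ∀ m : M, r • m ∈ D → m ∈ D) →
      ∃ C : Submodule R M, IsCompl D C) : IsExtendingModule R M :=
  fun N => ⟨pureClosure N, h _ (pureClosure_closed N), pureClosure_essential hM N⟩

lemma smul_div_cancel {K : Type u} [Field K] [Algebra R K] [IsFractionRing R K]
    {V : Type u} [AddCommGroup V] [Module R V] [Module K V] [IsScalarTower R K V]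
    (r : R) (hr : r ≠ 0) (v : V) : ∃ w : V, r • w = v := by
  have h : algebraMap R K r ≠ 0 := by
    simpa using hr
  exact ⟨(algebraMap R K r)⁻¹ • v, by rw [← algebraMap_smul K r, smul_smul, mul_inv_cancel₀ h, one_smul]⟩

lemma torsionFree_vec {K : Type u} [Field K] [Algebra R K] [IsFractionRing R K]
    {V : Type u} [AddCommGroup V] [Module R V] [Module K V] [IsScalarTower R K V]
    : IsTorsionFreeModule R V := by
  intro r m h
  rw [← algebraMap_smul K r, smul_eq_zero] at h
  simpa using h

lemma closed_compl {K : Type u} [Field K] [Algebra R K] [IsFractionRing R K]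
    {V : Type u} [AddCommGroup V] [Module R V] [Module K V] [IsScalarTower R K V]
    (D : Submodule R V)
    (hD : ∀ (r : R), r ≠ 0 → ∀ m : V, r • m ∈ D → m ∈ D) :
    ∃ C : Submodule R V, IsCompl D C := by
  let D' : Submodule K V :=
    { D with
      smul_mem' := by
        intro k m hm
        obtain ⟨a, b, hb, rfl⟩ := IsFractionRing.div_surjective (A := R) k
        have hb' : b ≠ 0 := nonZeroDivisors.ne_zero hb
        have h : algebraMap R K b ≠ 0 := by simpa using hb'
        refine hD b hb' _ ?_
        rw [← algebraMap_smul K b, smul_smul, mul_div_cancel₀ _ h, algebraMap_smul]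
        exact D.smul_mem _ hm }
  obtain ⟨C, hC⟩ := exists_isCompl D'
  refine ⟨C.restrictScalars R, ?_⟩
  have hm : ∀ x, x ∈ D' ↔ x ∈ D := fun x => Iff.rfl
  refine IsCompl.of_eq ?_ ?_
  · rw [eq_bot_iff]
    rintro x ⟨h1, h2⟩
    have : x ∈ D' ⊓ C := ⟨h1, h2⟩
    rw [hC.inf_eq_bot] at this
    simpa using this
  · rw [eq_top_iff]
    rintro x -
    have : x ∈ D' ⊔ C := by rw [hC.sup_eq_top]; trivial
    obtain ⟨y, hy, z, hz, rfl⟩ := Submodule.mem_sup.1 this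
    exact Submodule.add_mem_sup hy hz

lemma extending_vec {K : Type u} [Field K] [Algebra R K] [IsFractionRing R K]
    {V : Type u} [AddCommGroup V] [Module R V] [Module K V] [IsScalarTower R K V]
    : IsExtendingModule R V :=
  extending_of_closed (torsionFree_vec (K := K)) (closed_compl (K := K))

lemma torsionFree_prod {K : Type u} [Field K] [Algebra R K] [IsFractionRing R K]
    {V : Type u} [AddCommGroup V] [Module R V] [Module K V] [IsScalarTower R K V]
    : IsTorsionFreeModule R (V × R) := by
  rintro r ⟨v, s⟩ h
  rw [Prod.smul_mk, Prod.mk_eq_zero] at h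
  by_cases hr : r = 0
  · exact Or.inl hr
  · right
    rw [Prod.mk_eq_zero]
    exact ⟨(torsionFree_vec (K := K) r v h.1).resolve_left hr,
      (mul_eq_zero.1 h.2).resolve_left hr⟩

lemma extending_prod {K : Type u} [Field K] [Algebra R K] [IsFractionRing R K]
    {V : Type u} [AddCommGroup V] [Module R V] [Module K V] [IsScalarTower R K V]
    : IsExtendingModule R (V × R) := by
  refine extending_of_closed (torsionFree_prod (K := K)) fun D hD => ?_
  obtain ⟨C, hC⟩ := closed_compl (K := K) (D.comap (LinearMap.inl R V R)) (by
    intro r hr m hm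
    refine hD r hr _ ?_
    simpa using hm)
  have hdec : ∀ v : V, ∃ d c : V, (d, (0 : R)) ∈ D ∧ c ∈ C ∧ d + c = v := by
    intro v
    have : v ∈ D.comap (LinearMap.inl R V R) ⊔ C := by rw [hC.sup_eq_top]; trivial
    obtain ⟨y, hy, z, hz, h⟩ := Submodule.mem_sup.1 this
    exact ⟨y, z, by simpa using hy, hz, h⟩
  have hint : ∀ v : V, (v, (0 : R)) ∈ D → v ∈ C → v = 0 := by
    intro v h1 h2
    have : v ∈ D.comap (LinearMap.inl R V R) ⊓ C := ⟨by simpa using h1, h2⟩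
    rw [hC.inf_eq_bot] at this
    simpa using this
  by_cases hcase : ∀ x ∈ D, x.2 = 0
  · refine ⟨C.prod ⊤, IsCompl.of_eq ?_ ?_⟩
    · rw [eq_bot_iff]
      rintro ⟨v, s⟩ ⟨h1, h2⟩
      have hs : s = 0 := hcase _ h1
      subst hs
      have hv := hint v h1 h2.1
      simp [hv]
    · rw [eq_top_iff]
      rintro ⟨v, s⟩ -
      obtain ⟨d, c, hd, hc, rfl⟩ := hdec v
      refine Submodule.mem_sup.2 ⟨(d, 0), hd, (c, s), ⟨hc, trivial⟩, by simp⟩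
  · push Not at hcase
    obtain ⟨⟨v, r⟩, hx, hr⟩ := hcase
    obtain ⟨w, rfl⟩ := smul_div_cancel (K := K) r hr v
    have hw : (w, (1 : R)) ∈ D := hD r hr _ (by simpa using hx)
    refine ⟨C.prod ⊥, IsCompl.of_eq ?_ ?_⟩
    · rw [eq_bot_iff]
      rintro ⟨v, s⟩ ⟨h1, h2⟩
      have hs : s = 0 := h2.2
      subst hs
      have hv := hint v h1 h2.1
      simp [hv]
    · rw [eq_top_iff]
      rintro ⟨v, s⟩ -
      obtain ⟨d, c, hd, hc, h⟩ := hdec (v - s • w)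
      refine Submodule.mem_sup.2 ⟨(d, 0) + s • (w, 1), D.add_mem hd (D.smul_mem _ hw),
        (c, 0), ⟨hc, rfl⟩, ?_⟩
      ext
      · have : v = d + c + s • w := by rw [h]; abel
        simp only [Prod.smul_mk, Prod.mk_add_mk, this]; abel
      · simp

lemma field_of_torsionFree_SB
    (H : ∀ (X : Type u) [AddCommGroup X] [Module R X]
        (Y : Type u) [AddCommGroup Y] [Module R Y],
        IsTorsionFreeModule R X → IsTorsionFreeModule R Y →
        IsExtendingModule R X → IsExtendingModule R Y →
        Subisomorphic R X Y → Nonempty (X ≃ₗ[R] Y)) : IsField R := by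
  let K := FractionRing R
  obtain ⟨e⟩ := H (ℕ → K) ((ℕ → K) × R) (torsionFree_vec (K := K)) (torsionFree_prod (K := K))
    (extending_vec (K := K)) (extending_prod (K := K))
    ⟨⟨LinearMap.inl R _ _, LinearMap.inl_injective⟩,
     ⟨{ toFun := fun x n => Nat.casesOn n (algebraMap R K x.2) x.1
        map_add' := by
          intro x y; funext n; cases n <;> simp
        map_smul' := by
          intro r x; funext n; cases n <;> simp [Algebra.smul_def] }, by
      rintro ⟨x, a⟩ ⟨y, b⟩ h
      have h0 := congrFun h 0
      have h1 : x = y := funext fun n => congrFun h (n + 1)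
      have h2 : a = b := IsFractionRing.injective R K h0
      rw [h1, h2]⟩⟩
  refine ⟨exists_pair_ne R, mul_comm, fun {r} hr => ?_⟩
  obtain ⟨w, hw⟩ := smul_div_cancel (K := K) r hr (e.symm (0, 1))
  refine ⟨(e w).2, ?_⟩
  have := congrArg e hw
  rw [map_smul, e.apply_symm_apply] at this
  exact congrArg Prod.snd this

lemma iso_of_field (hR : IsField R) (X : Type u) [AddCommGroup X] [Module R X]
    (Y : Type u) [AddCommGroup Y] [Module R Y] (h : Subisomorphic R X Y) :
    Nonempty (X ≃ₗ[R] Y) := by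
  let _ := hR.toField
  have : Module.Free R X := Module.Free.of_divisionRing R X
  have : Module.Free R Y := Module.Free.of_divisionRing R Y
  obtain ⟨⟨f, hf⟩, ⟨g, hg⟩⟩ := h
  exact nonempty_linearEquiv_of_rank_eq
    (le_antisymm (LinearMap.rank_le_of_injective f hf) (LinearMap.rank_le_of_injective g hg))

end Helpers

/-- For a commutative domain `R`, the following are equivalent:
(a) any pair of mutually subisomorphic extending `R`-modules are isomorphic;
(b) any pair of mutually subisomorphic torsion-free extending `R`-modules are isomorphic;
(c) `R` is a field. -/
theorem extending_SB_iff_field (R : Type u) [CommRing R] [IsDomain R] :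
    ((∀ (X : Type u) [AddCommGroup X] [Module R X]
        (Y : Type u) [AddCommGroup Y] [Module R Y],
        IsExtendingModule R X → IsExtendingModule R Y →
        Subisomorphic R X Y → Nonempty (X ≃ₗ[R] Y)) ↔
      (∀ (X : Type u) [AddCommGroup X] [Module R X]
        (Y : Type u) [AddCommGroup Y] [Module R Y],
        IsTorsionFreeModule R X → IsTorsionFreeModule R Y →
        IsExtendingModule R X → IsExtendingModule R Y →
        Subisomorphic R X Y → Nonempty (X ≃ₗ[R] Y))) ∧
    ((∀ (X : Type u) [AddCommGroup X] [Module R X]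
        (Y : Type u) [AddCommGroup Y] [Module R Y],
        IsTorsionFreeModule R X → IsTorsionFreeModule R Y →
        IsExtendingModule R X → IsExtendingModule R Y →
        Subisomorphic R X Y → Nonempty (X ≃ₗ[R] Y)) ↔
      IsField R) := by
  exact ⟨⟨fun H X _ _ Y _ _ _ _ hX hY h => H X Y hX hY h,
      fun H X _ _ Y _ _ _ _ h => iso_of_field (field_of_torsionFree_SB H) X Y h⟩,
    ⟨field_of_torsionFree_SB, fun hR X _ _ Y _ _ _ _ _ _ h => iso_of_field hR X Y h⟩⟩
end

section
/- Let R be a commutative principal ideal ring (every ideal of R is principal). If any pair of torsion extending R-modules that are subisomorphic to each other are isomorphic, then R has Krull dimension zero, i.e., every prime ideal of R is maximal. -/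
universe u v

/-- Zorn: grow a submodule inside the family of submodules whose meet with `B` is `≤ S`. -/
lemma exists_max_meet {R : Type u} [CommRing R] {V : Type v} [AddCommGroup V] [Module R V]
    (B S E N : Submodule R V) (hN : N ⊓ B ≤ S) (hE : N ≤ E) :
    ∃ D : Submodule R V, N ≤ D ∧ D ⊓ B ≤ S ∧ D ≤ E ∧
      ∀ D' : Submodule R V, D ≤ D' → D' ⊓ B ≤ S → D' ≤ E → D' ≤ D := by
  obtain ⟨D, hND, hmax⟩ := zorn_le_nonempty₀ {D : Submodule R V | D ⊓ B ≤ S ∧ D ≤ E}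
    (by
      intro c hc hchain y hy
      refine ⟨sSup c, ⟨?_, sSup_le fun z hz => (hc hz).2⟩, fun z hz => le_sSup hz⟩
      rintro x ⟨hx1, hx2⟩
      obtain ⟨z, hz, hxz⟩ := (Submodule.mem_sSup_of_directed ⟨y, hy⟩ hchain.directedOn).1 hx1
      exact (hc hz).1 ⟨hxz, hx2⟩) N ⟨hN, hE⟩
  exact ⟨D, hND, hmax.prop.1, hmax.prop.2, fun D' h1 h2 h3 => hmax.le_of_ge ⟨h2, h3⟩ h1⟩

lemma exists_compl_in {R : Type u} [CommRing R] {V : Type v} [AddCommGroup V] [Module R V]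
    (m : R) (hm : ∀ r : R, (∃ c, r = m * c) ∨ ∃ r' c, r * r' = 1 + m * c)
    (A B W : Submodule R V) (hB : ∀ x ∈ B, m • x = 0) (_hA : A ≤ B) (hW : W ≤ B)
    (hAW : W ⊓ A ≤ ⊥) :
    ∃ C : Submodule R V, W ≤ C ∧ C ⊓ A ≤ ⊥ ∧ C ≤ B ∧ B ≤ A ⊔ C := by
  obtain ⟨C, h1, h2, h3, h4⟩ := exists_max_meet A ⊥ B W hAW hW
  refine ⟨C, h1, h2, h3, ?_⟩
  intro b hb
  by_contra hbn
  apply hbn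
  apply (le_sup_right : C ≤ A ⊔ C)
  refine h4 (C ⊔ R ∙ b) le_sup_left ?_ (sup_le h3 (by simpa using hb))
    ((le_sup_right : _ ≤ C ⊔ R ∙ b) (Submodule.mem_span_singleton_self b))
  rintro x ⟨hx1, hx2⟩
  obtain ⟨c, hc, y, hy, rfl⟩ := Submodule.mem_sup.1 hx1
  obtain ⟨r, rfl⟩ := Submodule.mem_span_singleton.1 hy
  rcases hm r with ⟨d, rfl⟩ | ⟨r', d, hr⟩
  · have : (m * d) • b = 0 := by rw [mul_comm, mul_smul, hB b hb, smul_zero]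
    rw [this, add_zero] at hx2 ⊢
    exact h2 ⟨hc, hx2⟩
  · exfalso
    apply hbn
    have : b = r' • (c + r • b) + (-r') • c := by
      have e : (r * r') • b = b := by
        rw [hr, add_smul, one_smul, mul_comm, mul_smul, hB b hb, smul_zero, add_zero]
      rw [smul_add, neg_smul, smul_smul, mul_comm r' r, e]; abel
    rw [this]
    exact Submodule.add_mem_sup (A.smul_mem _ hx2) (C.smul_mem _ hc)

lemma exists_closure {R : Type u} [CommRing R] {V : Type v} [AddCommGroup V] [Module R V]
    (m : R) (hm : ∀ r : R, (∃ c, r = m * c) ∨ ∃ r' c, r * r' = 1 + m * c)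
    (hV : ∀ x : V, m • m • x = 0) (N : Submodule R V) :
    ∃ D : Submodule R V, N ≤ D ∧ (∀ x ∈ D, m • x = 0 → x ∈ N) ∧
      ∀ v : V, m • v ∈ N → ∃ d ∈ D, m • v = m • d := by
  obtain ⟨D, h1, h2, -, h4⟩ := exists_max_meet (LinearMap.ker (LinearMap.lsmul R V m)) N ⊤ N
    inf_le_left le_top
  refine ⟨D, h1, fun x hx hx0 => h2 ⟨hx, by simpa using hx0⟩, ?_⟩
  intro v hv
  by_contra hcon
  apply hcon
  refine ⟨v, ?_, rfl⟩
  refine h4 (D ⊔ R ∙ v) le_sup_left ?_ le_top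
    ((le_sup_right : _ ≤ D ⊔ R ∙ v) (Submodule.mem_span_singleton_self v))
  rintro x ⟨hx1, hx2⟩
  obtain ⟨d, hd, y, hy, rfl⟩ := Submodule.mem_sup.1 hx1
  obtain ⟨r, rfl⟩ := Submodule.mem_span_singleton.1 hy
  have hx3 : m • (d + r • v) = 0 := by simpa using hx2
  rcases hm r with ⟨c, rfl⟩ | ⟨r', c, hr⟩
  · apply h2
    refine ⟨D.add_mem hd ?_, hx2⟩
    rw [mul_comm, mul_smul]
    exact D.smul_mem _ (h1 hv)
  · exfalso
    apply hcon
    refine ⟨(-r') • d, D.smul_mem _ hd, ?_⟩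
    have e : (r * r') • m • v = m • v := by
      rw [hr, add_smul, one_smul, mul_comm, mul_smul, hV, smul_zero, add_zero]
    have e2 : r' • m • d + (r * r') • m • v = 0 := by
      have := congrArg (fun z => r' • z) hx3
      simp only [smul_zero] at this
      rw [← this, smul_add, smul_add, mul_comm r r', mul_smul, smul_comm r m]
    rw [e] at e2
    rw [neg_smul, smul_neg, smul_comm m r']
    exact (neg_eq_of_add_eq_zero_right e2).symm

lemma extending_of_sq {R : Type u} [CommRing R] {V : Type v} [AddCommGroup V] [Module R V]
    (m : R) (hm : ∀ r : R, (∃ c, r = m * c) ∨ ∃ r' c, r * r' = 1 + m * c)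
    (hV : ∀ x : V, m • m • x = 0) : IsExtendingModule R V := by
  intro N
  obtain ⟨D, hND, hD1, hD2⟩ := exists_closure m hm hV N
  set K : Submodule R V := LinearMap.ker (LinearMap.lsmul R V m) with hK
  have memK : ∀ x, x ∈ K ↔ m • x = 0 := fun x => by simp [hK]
  set I : Submodule R V := LinearMap.range (LinearMap.lsmul R V m) with hI
  have memI : ∀ x, x ∈ I ↔ ∃ v, m • v = x := fun x => by simp [hI]
  have hIK : I ≤ K := by
    intro x hx
    obtain ⟨v, rfl⟩ := (memI x).1 hx
    exact (memK _).2 (hV v)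
  obtain ⟨W, -, hW1, hW2, hW3⟩ := exists_compl_in m hm (N ⊓ I) I ⊥
    (fun x hx => (memK x).1 (hIK hx)) inf_le_right bot_le (by simp)
  obtain ⟨T, hT0, hT1, hT2, hT3⟩ := exists_compl_in m hm (N ⊓ K) K W
    (fun x hx => (memK x).1 hx) inf_le_right (hW2.trans hIK) (by
      rintro x ⟨hx1, hx2, hx3⟩
      exact hW1 ⟨hx1, hx2, hW2 hx1⟩)
  obtain ⟨D', hTD, hD1', hD2'⟩ := exists_closure m hm hV T
  have key : ∀ x ∈ D, x ∈ D' → m • x = 0 → x = 0 := fun x h1 h2 h3 =>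
    (Submodule.mem_bot R).1 (hT1 ⟨hD1' x h2 h3, hD1 x h1 h3, (memK x).2 h3⟩)
  refine ⟨D, ⟨D', ?_, ?_⟩, hND, ?_⟩
  · rw [Submodule.disjoint_def]
    intro x h1 h2
    exact key x h1 h2 (key _ (D.smul_mem _ h1) (D'.smul_mem _ h2) (hV x))
  · rw [codisjoint_iff_le_sup]
    intro v _
    obtain ⟨s, hs, w, hw, hsw⟩ := Submodule.mem_sup.1 (hW3 ((memI (m • v)).2 ⟨v, rfl⟩))
    obtain ⟨a, rfl⟩ := (memI s).1 hs.2
    obtain ⟨b, rfl⟩ := (memI w).1 (hW2 hw)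
    obtain ⟨d, hd, hd'⟩ := hD2 a hs.1
    obtain ⟨e, he, he'⟩ := hD2' b (hT0 hw)
    have hk : v - (d + e) ∈ K := by
      rw [memK, smul_sub, smul_add, ← hd', ← he', hsw, sub_self]
    have h1 : v - (d + e) ∈ D ⊔ D' :=
      (sup_le_sup (inf_le_left.trans hND) hTD) (hT3 hk)
    have := (D ⊔ D').add_mem h1 (Submodule.add_mem_sup hd he)
    simpa using this
  · intro L hL hLN
    rw [eq_bot_iff]
    intro x hx
    have h0 : ∀ y ∈ L, m • y = 0 → y = 0 := fun y hy h => by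
      have : y ∈ L ⊓ N := ⟨hy, hD1 y (hL hy) h⟩
      rwa [hLN, Submodule.mem_bot] at this
    exact (Submodule.mem_bot R).2 (h0 x hx (h0 _ (L.smul_mem _ hx) (hV x)))

/-- Let `R` be a commutative principal ideal ring. If any pair of mutually
subisomorphic torsion (i.e. singular) extending `R`-modules are isomorphic, then every
prime ideal of `R` is maximal. -/
theorem dim_zero_of_torsion_extending_SB
    (R : Type u) [CommRing R]
    (hpir : ∀ I : Ideal R, I.IsPrincipal)
    (h : ∀ (X : Type u) [AddCommGroup X] [Module R X]
      (Y : Type u) [AddCommGroup Y] [Module R Y],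
      IsSingularModule R X → IsSingularModule R Y →
      IsExtendingModule R X → IsExtendingModule R Y →
      Subisomorphic R X Y → Nonempty (X ≃ₗ[R] Y)) :
    ∀ P : Ideal R, P.IsPrime → P.IsMaximal := by
  intro P hP
  by_contra hPm
  obtain ⟨M, hM, hPM⟩ := Ideal.exists_le_maximal P hP.ne_top
  obtain ⟨m, rfl⟩ := (hpir M).principal
  obtain ⟨p, rfl⟩ := (hpir P).principal
  rw [Ideal.submodule_span_eq] at *
  have hmP : m ∉ Ideal.span {p} := by
    intro hmem
    apply hPm
    have : Ideal.span {m} = Ideal.span {p} :=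
      le_antisymm ((Ideal.span_singleton_le_iff_mem _).2 hmem) hPM
    rwa [← this]
  have hcancel : ∀ x, m * x ∈ Ideal.span {p} → x ∈ Ideal.span {p} :=
    fun x hx => (hP.mem_or_mem hx).resolve_left hmP
  obtain ⟨a, ha⟩ := Ideal.mem_span_singleton'.1 (hPM (Ideal.mem_span_singleton_self p))
  obtain ⟨b, hb⟩ := Ideal.mem_span_singleton'.1
    (hcancel a (by rw [mul_comm, ha]; exact Ideal.mem_span_singleton_self p))
  -- `p = b * p * m`
  have hpbm : p = b * p * m := by rw [hb, ha]
  have hm : ∀ r : R, (∃ c, r = m * c) ∨ ∃ r' c, r * r' = 1 + m * c := by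
    intro r
    by_cases hr : r ∈ Ideal.span {m}
    · left
      exact Ideal.mem_span_singleton.1 hr
    · right
      obtain ⟨y, i, hi, hyi⟩ := hM.exists_inv hr
      obtain ⟨c, rfl⟩ := Ideal.mem_span_singleton.1 hi
      exact ⟨y, -c, by linear_combination hyi⟩
  have hsing : ∀ (V : Type u) [AddCommGroup V] [Module R V], (∀ x : V, m • m • x = 0) →
      IsSingularModule R V := by
    intro V _ _ hV v J hJ
    rw [eq_bot_iff]
    intro x hx
    have hann : ∀ y : R, y * m * m ∈ annihilatorOf R v := by
      intro y
      simp [annihilatorOf, mul_smul, hV]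
    have hz : x * m * m = 0 := by
      have : x * m * m ∈ J ⊓ annihilatorOf R v := by
        refine ⟨?_, hann x⟩
        have := J.smul_mem (m * m) hx
        rw [smul_eq_mul] at this
        have e : x * m * m = m * m * x := by ring
        rw [e]
        exact this
      rwa [hJ, Submodule.mem_bot] at this
    have hxP : x ∈ Ideal.span {p} := by
      apply hcancel
      apply hcancel
      have : m * (m * x) = 0 := by linear_combination hz
      rw [this]
      exact Ideal.zero_mem _
    obtain ⟨y, rfl⟩ := Ideal.mem_span_singleton'.1 hxP
    have e : y * p = (y * b * b * p) * m * m := by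
      linear_combination (y + y * b * m) * hpbm
    have : y * p ∈ J ⊓ annihilatorOf R v := ⟨hx, by rw [e]; exact hann _⟩
    rwa [hJ] at this
  -- the modules
  have hA : ∀ x : R ⧸ Ideal.span {m * m}, m • m • x = 0 := by
    intro x
    obtain ⟨r, rfl⟩ := Ideal.Quotient.mk_surjective x
    rw [smul_smul, ← Ideal.Quotient.mk_eq_mk, ← Submodule.Quotient.mk_smul,
      Submodule.Quotient.mk_eq_zero]
    exact Ideal.mem_span_singleton.2 ⟨r, by simp⟩
  have hk : ∀ x : R ⧸ Ideal.span {m}, m • x = 0 := by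
    intro x
    obtain ⟨r, rfl⟩ := Ideal.Quotient.mk_surjective x
    rw [← Ideal.Quotient.mk_eq_mk, ← Submodule.Quotient.mk_smul,
      Submodule.Quotient.mk_eq_zero]
    exact Ideal.mem_span_singleton.2 ⟨r, by simp⟩
  have hmm : ∀ r, m * r ∈ Ideal.span {m * m} → r ∈ Ideal.span {m} := by
    intro r hr
    obtain ⟨c, hc⟩ := Ideal.mem_span_singleton.1 hr
    have : r - m * c ∈ Ideal.span {p} := by
      apply hcancel
      have : m * (r - m * c) = 0 := by linear_combination hc
      rw [this]
      exact Ideal.zero_mem _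
    have h2 := Ideal.add_mem _ (hPM this) (Ideal.mul_mem_right c _ (Ideal.mem_span_singleton_self m))
    simpa using h2
  have hX : ∀ x : ℕ → R ⧸ Ideal.span {m * m}, m • m • x = 0 :=
    fun x => funext fun n => hA (x n)
  have hY : ∀ x : (R ⧸ Ideal.span {m}) × (ℕ → R ⧸ Ideal.span {m * m}), m • m • x = 0 :=
    fun x => Prod.ext (by simp [hk]) (hX x.2)
  let ι : (R ⧸ Ideal.span {m}) →ₗ[R] (R ⧸ Ideal.span {m * m}) :=
    Submodule.mapQ (Ideal.span {m}) (Ideal.span {m * m}) (LinearMap.lsmul R R m) (by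
      intro r hr
      obtain ⟨c, rfl⟩ := Ideal.mem_span_singleton.1 hr
      exact Ideal.mem_span_singleton.2 ⟨c, by simp [mul_assoc]⟩)
  have hι : ∀ x, ι x = 0 → x = 0 := by
    intro x hx
    obtain ⟨r, rfl⟩ := Submodule.Quotient.mk_surjective _ x
    have hx' : (Submodule.Quotient.mk (m * r) : R ⧸ Ideal.span {m * m}) = 0 := hx
    rw [Submodule.Quotient.mk_eq_zero] at hx' ⊢
    exact hmm r hx'
  let g : ((R ⧸ Ideal.span {m}) × (ℕ → R ⧸ Ideal.span {m * m})) →ₗ[R]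
      (ℕ → R ⧸ Ideal.span {m * m}) :=
    LinearMap.pi (fun n => match n with
      | 0 => ι ∘ₗ LinearMap.fst R _ _
      | n + 1 => LinearMap.proj n ∘ₗ LinearMap.snd R _ _)
  have hg : Function.Injective g := by
    rw [injective_iff_map_eq_zero]
    intro x hx
    refine Prod.ext (hι _ (congrFun hx 0)) (funext fun n => congrFun hx (n + 1))
  obtain ⟨e⟩ := h (ℕ → R ⧸ Ideal.span {m * m})
    ((R ⧸ Ideal.span {m}) × (ℕ → R ⧸ Ideal.span {m * m}))
    (hsing _ hX) (hsing _ hY) (extending_of_sq m hm hX) (extending_of_sq m hm hY)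
    ⟨⟨LinearMap.inr R _ _, LinearMap.inr_injective⟩, ⟨g, hg⟩⟩
  -- in `X`, the kernel of `m` is `m X`
  have hker : ∀ x : ℕ → R ⧸ Ideal.span {m * m}, m • x = 0 → ∃ y, x = m • y := by
    intro x hx
    have : ∀ n, ∃ y, x n = m • y := by
      intro n
      have hn : m • x n = 0 := congrFun hx n
      obtain ⟨r, hr⟩ := Submodule.Quotient.mk_surjective _ (x n)
      rw [← hr, ← Submodule.Quotient.mk_smul, Submodule.Quotient.mk_eq_zero] at hn
      obtain ⟨c, rfl⟩ := Ideal.mem_span_singleton.1 (hmm r hn)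
      exact ⟨Submodule.Quotient.mk c, hr.symm⟩
    choose y hy using this
    exact ⟨y, funext hy⟩
  obtain ⟨y, hy⟩ := hker (e.symm (1, 0)) (by
    rw [← map_smul]
    have : m • ((1, 0) : (R ⧸ Ideal.span {m}) × (ℕ → R ⧸ Ideal.span {m * m})) = 0 :=
      Prod.ext (hk 1) (smul_zero _)
    rw [this, map_zero])
  have h1 : ((1, 0) : (R ⧸ Ideal.span {m}) × (ℕ → R ⧸ Ideal.span {m * m})) = m • e y := by
    rw [← map_smul, ← hy, e.apply_symm_apply]
  have h2 : (1 : R ⧸ Ideal.span {m}) = 0 := by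
    have := congrArg Prod.fst h1
    rw [Prod.smul_fst, hk] at this
    exact this
  have h3 : (1 : R) ∈ Ideal.span {m} := by
    rw [← Ideal.Quotient.eq_zero_iff_mem, map_one, h2]
  exact hM.ne_top ((Ideal.eq_top_iff_one _).2 h3)
end

section
/- Let R be a principal ideal domain. Then any pair of torsion extending R-modules that are subisomorphic to each other are isomorphic if and only if R is a field. -/
universe u v

/-- Extending a disjoint submodule to a complement inside a submodule killed by `p`. -/
theorem aux_compl {R : Type u} [CommRing R] [IsDomain R] [IsPrincipalIdealRing R]
    {M : Type v} [AddCommGroup M] [Module R M] {p : R} (hp : Irreducible p)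
    (A B T : Submodule R M) (hT : ∀ x ∈ T, p • x = 0) (hBT : B ≤ T)
    (hAB : A ⊓ B = ⊥) :
    ∃ C : Submodule R M, B ≤ C ∧ C ≤ T ∧ A ⊓ C = ⊥ ∧ T ≤ A ⊔ C := by
  obtain ⟨C, hBC, hC⟩ := zorn_le_nonempty₀ {C : Submodule R M | C ≤ T ∧ A ⊓ C = ⊥}
    (by
      intro c hc hchain y hy
      refine ⟨sSup c, ⟨sSup_le fun z hz => (hc hz).1, ?_⟩, fun z hz => le_sSup hz⟩
      rw [eq_bot_iff]
      rintro x ⟨hxA, hx⟩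
      obtain ⟨D, hD, hxD⟩ := (Submodule.mem_sSup_of_directed ⟨y, hy⟩ hchain.directedOn).1 hx
      rw [← (hc hD).2]
      exact ⟨hxA, hxD⟩) B ⟨hBT, hAB⟩
  refine ⟨C, hBC, hC.prop.1, hC.prop.2, ?_⟩
  intro x hx
  by_contra hxn
  have hxC : x ∉ C := fun h => hxn (Submodule.mem_sup_right h)
  apply hxC
  refine hC.le_of_ge (y := C ⊔ Submodule.span R {x}) ⟨?_, ?_⟩ le_sup_left
    (Submodule.mem_sup_right (Submodule.mem_span_singleton_self x))
  · exact sup_le hC.prop.1 (by simpa using hx)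
  · rw [eq_bot_iff]
    rintro a ⟨haA, ha⟩
    obtain ⟨c, hc, z, hz, rfl⟩ := Submodule.mem_sup.1 ha
    obtain ⟨r, rfl⟩ := Submodule.mem_span_singleton.1 hz
    by_cases hr : p ∣ r
    · obtain ⟨r', rfl⟩ := hr
      have h0 : (p * r') • x = 0 := by rw [mul_comm, mul_smul, hT x hx, smul_zero]
      rw [h0, add_zero] at haA ⊢
      rw [← hC.prop.2]
      exact ⟨haA, hc⟩
    · exfalso
      obtain ⟨t, s, hst⟩ := (hp.coprime_iff_not_dvd).2 hr
      apply hxn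
      have h1 : x = s • (c + r • x) - s • c := by
        have : (t * p + s * r) • x = x := by rw [hst, one_smul]
        rw [add_smul, mul_smul, hT x hx, smul_zero, zero_add, mul_smul] at this
        rw [smul_add, this]; abel
      rw [h1]
      exact sub_mem (Submodule.mem_sup_left (A.smul_mem s haA))
        (Submodule.mem_sup_right (C.smul_mem s hc))

/-- Maximal essential extensions in a module killed by `p ^ 2`. -/
theorem aux_max {R : Type u} [CommRing R] [IsDomain R] [IsPrincipalIdealRing R]
    {M : Type v} [AddCommGroup M] [Module R M] {p : R} (hp : Irreducible p)
    (hM : ∀ x : M, p • p • x = 0) (N : Submodule R M) :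
    ∃ D : Submodule R M, N ≤ D ∧ (∀ x ∈ D, p • x = 0 → x ∈ N) ∧
      ∀ m : M, p • m ∈ N → ∃ y ∈ D, p • y = p • m := by
  obtain ⟨D, hND, hD⟩ := zorn_le_nonempty₀ {D : Submodule R M | ∀ x ∈ D, p • x = 0 → x ∈ N}
    (by
      intro c hc hchain y hy
      refine ⟨sSup c, ?_, fun z hz => le_sSup hz⟩
      intro x hx hpx
      obtain ⟨D, hD, hxD⟩ := (Submodule.mem_sSup_of_directed ⟨y, hy⟩ hchain.directedOn).1 hx
      exact hc hD x hxD hpx) N (fun x hx _ => hx)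
  refine ⟨D, hND, hD.prop, ?_⟩
  intro m hm
  by_contra hcon
  push Not at hcon
  have hmD : m ∉ D := fun h => hcon m h rfl
  apply hmD
  refine hD.le_of_ge (y := D ⊔ Submodule.span R {m}) ?_ le_sup_left
    (Submodule.mem_sup_right (Submodule.mem_span_singleton_self m))
  intro a ha hpa
  obtain ⟨e, he, z, hz, rfl⟩ := Submodule.mem_sup.1 ha
  obtain ⟨r, rfl⟩ := Submodule.mem_span_singleton.1 hz
  by_cases hr : p ∣ r
  · obtain ⟨r', rfl⟩ := hr
    refine hD.prop _ (D.add_mem he ?_) hpa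
    rw [mul_comm, mul_smul]
    exact D.smul_mem _ (hND hm)
  · exfalso
    obtain ⟨t, s, hst⟩ := (hp.coprime_iff_not_dvd).2 hr
    refine hcon (-(s • e)) (D.neg_mem (D.smul_mem s he)) ?_
    have h1 : p • m = (t * p + s * r) • p • m := by rw [hst, one_smul]
    rw [add_smul, mul_smul, hM, smul_zero, zero_add] at h1
    have h2 : s • (p • (e + r • m)) = 0 := by rw [hpa, smul_zero]
    rw [h1, smul_neg, neg_eq_iff_add_eq_zero, ← h2]
    module

/-- Every module killed by `p ^ 2` over a PID is extending. -/
theorem aux_extending {R : Type u} [CommRing R] [IsDomain R] [IsPrincipalIdealRing R]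
    {M : Type v} [AddCommGroup M] [Module R M] {p : R} (hp : Irreducible p)
    (hM : ∀ x : M, p • p • x = 0) : IsExtendingModule R M := by
  intro N
  let T : Submodule R M := LinearMap.ker (LinearMap.lsmul R M p)
  let P : Submodule R M := LinearMap.range (LinearMap.lsmul R M p)
  have hT : ∀ x, x ∈ T ↔ p • x = 0 := fun x => by simp [T]
  have hP : ∀ x, x ∈ P ↔ ∃ m : M, p • m = x := fun x => by simp [P]
  have hPT : P ≤ T := by
    intro x hx
    obtain ⟨m, rfl⟩ := (hP x).1 hx
    exact (hT _).2 (hM m)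
  obtain ⟨W, -, hWP, hW1, hW2⟩ := aux_compl hp (N ⊓ P) ⊥ P (fun x hx => (hT x).1 (hPT hx))
    bot_le (by simp)
  obtain ⟨S, hWS, hST, hS1, hS2⟩ := aux_compl hp N W T (fun x hx => (hT x).1 hx)
    (hWP.trans hPT) (by
      rw [← hW1, inf_assoc, inf_eq_right.2 hWP])
  have hS2' : ∀ x ∈ T, ∃ a ∈ N, ∃ b ∈ S, a + b = x := fun x hx => Submodule.mem_sup.1 (hS2 hx)
  obtain ⟨D, hND, hD1, hD2⟩ := aux_max hp hM N
  obtain ⟨E, hSE, hE1, hE2⟩ := aux_max hp hM S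
  refine ⟨D, ⟨E, ?_⟩, hND, ?_⟩
  · constructor
    · rw [disjoint_iff, eq_bot_iff]
      have key : ∀ x ∈ D, x ∈ E → p • x = 0 → x = 0 := by
        intro x hxD hxE hx
        have : x ∈ N ⊓ S := ⟨hD1 x hxD hx, hE1 x hxE hx⟩
        rw [hS1] at this
        exact (Submodule.mem_bot R).1 this
      rintro x ⟨hxD, hxE⟩
      refine (Submodule.mem_bot R).2 (key x hxD hxE ?_)
      exact key _ (D.smul_mem p hxD) (E.smul_mem p hxE) (hM x)
    · rw [codisjoint_iff, eq_top_iff]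
      intro x _
      obtain ⟨d, hd, w, hw, hdw⟩ := Submodule.mem_sup.1 (hW2 ((hP (p • x)).2 ⟨x, rfl⟩))
      obtain ⟨m, rfl⟩ := (hP d).1 hd.2
      obtain ⟨m', rfl⟩ := (hP w).1 (hWP hw)
      obtain ⟨y, hy, hy'⟩ := hD2 m hd.1
      obtain ⟨z, hz, hz'⟩ := hE2 m' (hWS hw)
      obtain ⟨a, ha, b, hb, hab⟩ := hS2' (x - y - z) ((hT _).2 (by
        rw [smul_sub, smul_sub, hy', hz', ← hdw]; abel))
      have : x = (y + a) + (z + b) := by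
        have : x = y + z + (x - y - z) := by abel
        rw [this, ← hab]; abel
      rw [this]
      exact add_mem (Submodule.mem_sup_left (D.add_mem hy (hND ha)))
        (Submodule.mem_sup_right (E.add_mem hz (hSE hb)))
  · intro L hLD hLN
    have key : ∀ x ∈ L, p • x = 0 → x = 0 := by
      intro x hxL hx
      have : x ∈ L ⊓ N := ⟨hxL, hD1 x (hLD hxL) hx⟩
      rw [hLN] at this
      exact (Submodule.mem_bot R).1 this
    rw [eq_bot_iff]
    intro x hx
    exact (Submodule.mem_bot R).2 (key x hx (key _ (L.smul_mem p hx) (hM x)))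

/-- Over a principal ideal domain `R`, any pair of mutually subisomorphic
torsion extending `R`-modules are isomorphic iff `R` is a field. -/
theorem torsion_extending_SB_iff_field
    (R : Type u) [CommRing R] [IsDomain R] [IsPrincipalIdealRing R] :
    (∀ (X : Type u) [AddCommGroup X] [Module R X]
      (Y : Type u) [AddCommGroup Y] [Module R Y],
      Module.IsTorsion R X → Module.IsTorsion R Y →
      IsExtendingModule R X → IsExtendingModule R Y →
      Subisomorphic R X Y → Nonempty (X ≃ₗ[R] Y)) ↔
    IsField R := by
  constructor
  · intro H
    by_contra hnf
    obtain ⟨a, ha0, hau⟩ : ∃ a : R, a ≠ 0 ∧ ¬ IsUnit a := by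
      obtain ⟨a, ha0, hau⟩ := Ring.not_isField_iff_exists_ideal_bot_lt_and_lt_top.1 hnf
      obtain ⟨x, hx, hx0⟩ := Submodule.exists_mem_ne_zero_of_ne_bot ha0.ne'
      exact ⟨x, hx0, fun hu => hau.ne (Ideal.eq_top_of_isUnit_mem _ hx hu)⟩
    obtain ⟨p, hp, -⟩ := WfDvdMonoid.exists_irreducible_factor hau ha0
    let Q := R ⧸ Ideal.span {p * p}
    have hQ : ∀ q : Q, p • p • q = 0 := by
      intro q
      obtain ⟨r, rfl⟩ := Ideal.Quotient.mk_surjective q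
      change Ideal.Quotient.mk _ (p * (p * r)) = 0
      rw [Ideal.Quotient.eq_zero_iff_mem, Ideal.mem_span_singleton]
      exact ⟨r, by ring⟩
    have hQd : ∀ q : Q, p • q = 0 → ∃ q' : Q, p • q' = q := by
      intro q hq
      obtain ⟨r, rfl⟩ := Ideal.Quotient.mk_surjective q
      change Ideal.Quotient.mk _ (p * r) = 0 at hq
      rw [Ideal.Quotient.eq_zero_iff_mem, Ideal.mem_span_singleton] at hq
      obtain ⟨s, rfl⟩ := (mul_dvd_mul_iff_left hp.ne_zero).1 hq
      exact ⟨Ideal.Quotient.mk _ s, rfl⟩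
    let X := ℕ →₀ Q
    have hX : ∀ x : X, p • p • x = 0 := fun x => by
      ext i
      exact hQ (x i)
    let Y : Submodule R X := LinearMap.ker ((LinearMap.lsmul R Q p).comp (Finsupp.lapply 0))
    have hYm : ∀ x : X, x ∈ Y ↔ p • x 0 = 0 := fun x => Iff.rfl
    have hY : ∀ x : Y, p • p • x = 0 := fun x => Subtype.ext (hX x)
    have hpp : p * p ∈ nonZeroDivisors R :=
      mem_nonZeroDivisors_of_ne_zero (mul_ne_zero hp.ne_zero hp.ne_zero)
    obtain ⟨φ⟩ := H X Y (fun x => ⟨⟨p * p, hpp⟩, (mul_smul p p x).trans (hX x)⟩)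
      (fun x => ⟨⟨p * p, hpp⟩, (mul_smul p p x).trans (hY x)⟩)
      (aux_extending hp hX) (aux_extending hp hY)
      ⟨⟨(Finsupp.lmapDomain Q R Nat.succ).codRestrict Y (fun x => by
          rw [hYm]
          have : (Finsupp.lmapDomain Q R Nat.succ) x 0 = 0 :=
            Finsupp.mapDomain_notin_range _ _ (by simp)
          rw [this, smul_zero]), by
          intro x y hxy
          exact Finsupp.mapDomain_injective Nat.succ_injective (congrArg Subtype.val hxy)⟩,
        ⟨Y.subtype, Y.injective_subtype⟩⟩
    have hXd : ∀ x : X, p • x = 0 → ∃ y : X, p • y = x := by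
      intro x hx
      have hc : ∀ q : Q, ∃ q' : Q, (p • q = 0 → p • q' = q) ∧ (q = 0 → q' = 0) := by
        intro q
        by_cases h0 : q = 0
        · exact ⟨0, fun _ => by rw [h0, smul_zero], fun _ => rfl⟩
        · by_cases h1 : p • q = 0
          · obtain ⟨q', hq'⟩ := hQd q h1
            exact ⟨q', fun _ => hq', fun h => absurd h h0⟩
          · exact ⟨0, fun h => absurd h h1, fun _ => rfl⟩
      choose g hg using hc
      refine ⟨x.mapRange g ((hg 0).2 rfl), ?_⟩
      ext i
      exact (hg (x i)).1 (DFunLike.congr_fun hx i)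
    let e : Q := Ideal.Quotient.mk _ p
    have he : p • e = 0 := by
      change Ideal.Quotient.mk _ (p * p) = 0
      rw [Ideal.Quotient.eq_zero_iff_mem]
      exact Ideal.mem_span_singleton_self _
    let y : Y := ⟨Finsupp.single 0 e, by rw [hYm, Finsupp.single_eq_same, he]⟩
    have hy : p • y = 0 := by
      apply Subtype.ext
      change p • (Finsupp.single 0 e : X) = 0
      rw [Finsupp.smul_single, he, Finsupp.single_zero]
    obtain ⟨x, hx⟩ := hXd (φ.symm y) (by rw [← map_smul, hy, map_zero])
    have hz : p • φ x = y := by rw [← map_smul, hx, LinearEquiv.apply_symm_apply]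
    have h0 : p • (φ x : X) 0 = e := by
      have := DFunLike.congr_fun (congrArg Subtype.val hz) 0
      exact this.trans Finsupp.single_eq_same
    rw [(hYm _).1 (φ x).2] at h0
    have h1 : Ideal.Quotient.mk (Ideal.span {p * p}) p = 0 := h0.symm
    rw [Ideal.Quotient.eq_zero_iff_mem, Ideal.mem_span_singleton] at h1
    have h2 : p * p ∣ p * 1 := by simpa using h1
    exact hp.not_isUnit (isUnit_of_dvd_one ((mul_dvd_mul_iff_left hp.ne_zero).1 h2))
  · intro hF X _ _ Y _ _ hX hY _ _ _
    have key : ∀ (Z : Type u) [AddCommGroup Z] [Module R Z], Module.IsTorsion R Z →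
        ∀ z : Z, z = 0 := by
      intro Z _ _ hZ z
      obtain ⟨⟨a, ha⟩, haz⟩ := @hZ z
      obtain ⟨b, hb⟩ := hF.mul_inv_cancel (nonZeroDivisors.ne_zero ha)
      have haz' : a • z = 0 := haz
      rw [← one_smul R z, ← hb, mul_comm, mul_smul, haz', smul_zero]
    haveI : Subsingleton X := ⟨fun a b => by rw [key X hX a, key X hX b]⟩
    haveI : Subsingleton Y := ⟨fun a b => by rw [key Y hY a, key Y hY b]⟩
    exact ⟨⟨0, 0, fun _ => Subsingleton.elim _ _, fun _ => Subsingleton.elim _ _⟩⟩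
end

section
/- Let R be a ring and let N and K be dual Rickart right R-modules. Then N and K are subisomorphic to each other if and only if N and K are d-subisomorphic to each other. -/
universe u v w

theorem isoToDirectSummand_of_injective
    (R : Type u) [Ring R]
    (N : Type v) [AddCommGroup N] [Module R N]
    (K : Type w) [AddCommGroup K] [Module R K]
    (hN : IsDualRickartModule R N) (f : N →ₗ[R] K) (hf : Function.Injective f)
    (g : K →ₗ[R] N) (hg : Function.Injective g) : IsoToDirectSummand R N K := by
  obtain ⟨C, hC⟩ := hN (g ∘ₗ f)
  refine ⟨LinearMap.range f, ⟨C.comap g, ?_, ?_⟩, ⟨LinearEquiv.ofInjective f hf⟩⟩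
  · rw [Submodule.disjoint_def]
    rintro _ ⟨x, rfl⟩ hx
    have h := Submodule.disjoint_def.1 hC.disjoint (g (f x)) ⟨x, rfl⟩ hx
    exact hg (by rw [h, map_zero])
  · rw [codisjoint_iff, eq_top_iff]
    intro k _
    have hk : g k ∈ LinearMap.range (g ∘ₗ f) ⊔ C := by
      rw [hC.sup_eq_top]; trivial
    obtain ⟨_, ⟨x, rfl⟩, c, hc, h⟩ := Submodule.mem_sup.1 hk
    refine Submodule.mem_sup.2 ⟨f x, ⟨x, rfl⟩, k - f x, ?_, by abel⟩
    have h2 : g (k - f x) = c := by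
      rw [map_sub, ← h, LinearMap.comp_apply, add_sub_cancel_left]
    rw [Submodule.mem_comap, h2]
    exact hc

/-- Two dual Rickart modules are mutually subisomorphic iff they are
mutually d-subisomorphic. -/
theorem dualRickart_subisomorphic_iff_dSubisomorphic
    (R : Type u) [Ring R]
    (N : Type v) [AddCommGroup N] [Module R N]
    (K : Type w) [AddCommGroup K] [Module R K]
    (hN : IsDualRickartModule R N) (hK : IsDualRickartModule R K) :
    Subisomorphic R N K ↔ DSubisomorphic R N K := by
  constructor
  · rintro ⟨⟨f, hf⟩, ⟨g, hg⟩⟩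
    exact ⟨isoToDirectSummand_of_injective R N K hN f hf g hg,
      isoToDirectSummand_of_injective R K N hK g hg f hf⟩
  · rintro ⟨⟨L, _, ⟨e⟩⟩, ⟨L', _, ⟨e'⟩⟩⟩
    exact ⟨⟨L.subtype ∘ₗ e.toLinearMap, L.injective_subtype.comp e.injective⟩,
      ⟨L'.subtype ∘ₗ e'.toLinearMap, L'.injective_subtype.comp e'.injective⟩⟩
end

section
/- Let R be a ring, let N be a dual Baer right R-module and let K be a dual Rickart right R-module. If N and K are subisomorphic to each other, then N ≅ K. -/
universe u v w

theorem idem_of_range {R : Type u} [Ring R] {N : Type v} [AddCommGroup N] [Module R N]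
    (hN : IsDualBaerModule R N) (f : Module.End R N) :
    ∃ e : Module.End R N, IsIdempotentElem e ∧ LinearMap.range e = LinearMap.range f := by
  obtain ⟨e, he, hf⟩ := hN (LinearMap.range f)
  refine ⟨e, he, le_antisymm ((hf e).2 ⟨1, by simp⟩) ?_⟩
  obtain ⟨g, hg⟩ := (hf f).1 le_rfl
  rintro _ ⟨x, rfl⟩
  exact ⟨g x, by rw [hg]; rfl⟩

/-- If `N` is a dual Baer module, `K` is a dual Rickart module and `N`, `K`
are mutually subisomorphic, then `N ≅ K`. -/
theorem dualBaer_dualRickart_subisomorphic_isomorphic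
    (R : Type u) [Ring R]
    (N : Type v) [AddCommGroup N] [Module R N]
    (K : Type w) [AddCommGroup K] [Module R K]
    (hN : IsDualBaerModule R N) (hK : IsDualRickartModule R K)
    (hsub : Subisomorphic R N K) :
    Nonempty (N ≃ₗ[R] K) := by
  obtain ⟨⟨f, hf⟩, g, hg⟩ := hsub
  obtain ⟨T', hT'⟩ := hK (f ∘ₗ g)
  set A : Submodule R N := T'.comap f with hA
  have hdA : ∀ k, g k ∈ A → g k = 0 := by
    intro k hk
    apply hf
    rw [map_zero]
    exact Submodule.disjoint_def.1 hT'.disjoint _ ⟨k, rfl⟩ hk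
  have hsA : ∀ n : N, ∃ k, n - g k ∈ A := by
    intro n
    have : f n ∈ LinearMap.range (f ∘ₗ g) ⊔ T' := by rw [hT'.sup_eq_top]; trivial
    obtain ⟨_, ⟨k, rfl⟩, t, ht, h⟩ := Submodule.mem_sup.1 this
    refine ⟨k, ?_⟩
    rw [hA, Submodule.mem_comap, map_sub, ← h]
    simpa using ht
  have hc : IsCompl A (LinearMap.range g) := by
    refine ⟨?_, ?_⟩
    · rw [Submodule.disjoint_def]
      rintro _ hx ⟨k, rfl⟩
      exact hdA k hx
    · rw [codisjoint_iff, eq_top_iff]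
      intro n _
      obtain ⟨k, hk⟩ := hsA n
      exact Submodule.mem_sup.2 ⟨_, hk, g k, ⟨k, rfl⟩, by simp⟩
  obtain ⟨π, hπ⟩ : ∃ π : Module.End R N, LinearMap.range π = A :=
    ⟨A.subtype ∘ₗ A.projectionOnto _ hc, by
      rw [LinearMap.range_comp_of_range_eq_top _ (by simp)]; simp⟩
  set h : Module.End R N := g ∘ₗ f with hh
  have hinj : Function.Injective h := hg.comp hf
  set P : Submodule R N := ⨆ n : ℕ, A.map (h ^ n) with hP
  have hAP : A ≤ P := by
    refine le_trans ?_ (le_iSup _ 0)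
    simp [Module.End.one_eq_id]
  have hPP : P.map h ≤ P := by
    rw [hP, Submodule.map_iSup]
    refine iSup_le fun n => le_trans ?_ (le_iSup _ (n+1))
    rw [pow_succ', Module.End.mul_eq_comp, Submodule.map_comp (h ^ n) h]
  have hPA : P ≤ A ⊔ P.map h := by
    refine iSup_le fun n => ?_
    cases n with
    | zero => simp [Module.End.one_eq_id]
    | succ n =>
      refine le_trans ?_ le_sup_right
      rw [pow_succ', Module.End.mul_eq_comp, Submodule.map_comp]
      exact Submodule.map_mono (le_iSup (fun n : ℕ => A.map (h ^ n)) n)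
  obtain ⟨e, -, he⟩ := hN P
  have heP : LinearMap.range e = P := by
    refine le_antisymm ((he e).2 ⟨1, by simp⟩) (iSup_le fun n => ?_)
    have hr : LinearMap.range (h ^ n * π) = A.map (h ^ n) := by
      rw [Module.End.mul_eq_comp, LinearMap.range_comp, hπ]
    obtain ⟨q, hq⟩ := (he (h ^ n * π)).1 (by rw [hr]; exact le_iSup (fun n : ℕ => A.map (h ^ n)) n)
    rw [← hr, hq]
    exact LinearMap.range_comp_le_range _ _
  obtain ⟨e2, hi, he2⟩ := idem_of_range hN (h * e)
  rw [Module.End.mul_eq_comp, LinearMap.range_comp, heP] at he2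
  have hi' : ∀ x, e2 (e2 x) = e2 x := fun x => LinearMap.congr_fun hi x
  have hm : ∀ x, e2 x ∈ P.map h := fun x => he2 ▸ LinearMap.mem_range_self e2 x
  have hfix : ∀ x ∈ P.map h, e2 x = x := by
    intro x hx
    rw [← he2] at hx
    obtain ⟨y, rfl⟩ := hx
    exact hi' y
  have hPg : P.map h ≤ LinearMap.range g := by
    rintro _ ⟨x, -, rfl⟩
    exact ⟨f x, rfl⟩
  set Q : Submodule R N := LinearMap.ker e2 ⊓ LinearMap.range g with hQ
  have hd0 : ∀ x ∈ P.map h, x ∈ Q → x = 0 := by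
    intro x hx hxQ
    rw [← hfix x hx]
    exact hxQ.1
  have hsplit : ∀ y ∈ LinearMap.range g, y - e2 y ∈ Q := fun y hy =>
    ⟨by simp [hi'], Submodule.sub_mem _ hy (hPg (hm y))⟩
  have hPQ : IsCompl P Q := by
    refine ⟨?_, ?_⟩
    · rw [Submodule.disjoint_def]
      intro x hx hxQ
      obtain ⟨a, ha, b, hb, hab⟩ := Submodule.mem_sup.1 (hPA hx)
      have ha' : a ∈ LinearMap.range g := by
        have : a = x - b := by rw [← hab]; simp
        rw [this]
        exact Submodule.sub_mem _ hxQ.2 (hPg hb)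
      have ha0 := Submodule.disjoint_def.1 hc.disjoint a ha ha'
      rw [ha0, zero_add] at hab
      exact hd0 x (hab ▸ hb) hxQ
    · rw [codisjoint_iff, eq_top_iff]
      intro n _
      obtain ⟨k, hk⟩ := hsA n
      refine Submodule.mem_sup.2 ⟨(n - g k) + e2 (g k),
        P.add_mem (hAP hk) (hPP (hm _)), g k - e2 (g k), hsplit _ ⟨k, rfl⟩, by abel⟩
  let φ : (P × Q) →ₗ[R] N := (h ∘ₗ P.subtype).coprod Q.subtype
  have hφ : Function.Injective φ := by
    rw [injective_iff_map_eq_zero]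
    rintro ⟨p, q⟩ hpq
    have hpq' : h p + (q : N) = 0 := by simpa [φ] using hpq
    have h1 : h p ∈ Q := by
      rw [eq_neg_of_add_eq_zero_left hpq']
      exact Q.neg_mem q.2
    have h2 : h p = 0 := hd0 _ ⟨p, p.2, rfl⟩ h1
    have h3 : (p : N) = 0 := hinj (by rw [h2, map_zero])
    rw [h2, zero_add] at hpq'
    ext
    · exact h3
    · exact hpq'
  have hr : LinearMap.range φ = LinearMap.range g := by
    apply le_antisymm
    · rintro _ ⟨⟨p, q⟩, rfl⟩
      have : φ (p, q) = h p + (q : N) := by simp [φ]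
      rw [this]
      exact Submodule.add_mem _ (hPg ⟨p, p.2, rfl⟩) q.2.2
    · intro y hy
      obtain ⟨p, hp, hpe⟩ := hm y
      refine ⟨(⟨p, hp⟩, ⟨_, hsplit y hy⟩), ?_⟩
      have : φ (⟨p, hp⟩, ⟨_, hsplit y hy⟩) = h p + (y - e2 y) := by simp [φ]
      rw [this, hpe]
      abel
  exact ⟨(Submodule.prodEquivOfIsCompl P Q hPQ).symm ≪≫ₗ LinearEquiv.ofInjective φ hφ ≪≫ₗ
    LinearEquiv.ofEq _ _ hr ≪≫ₗ (LinearEquiv.ofInjective g hg).symm⟩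
end

section
/- Let R be a ring such that every semisimple right R-module is injective. Then R is right Noetherian and every simple right R-module is injective (i.e., R is a right V-ring). -/
universe u v

/-- Over a V-ring, an element outside an ideal is detected by a map to a simple quotient. -/
theorem exists_simple_sep (R : Type u) [Ring R]
    (h : ∀ (M : Type u) [AddCommGroup M] [Module R M],
      IsSimpleModule R M → Module.Injective R M)
    (I : Submodule R R) (a : R) (ha : a ∉ I) :
    ∃ m : Submodule R R, IsCoatom m ∧ ∃ f : R →ₗ[R] R ⧸ m, (∀ x ∈ I, f x = 0) ∧ f a ≠ 0 := by
  let t : R →ₗ[R] R ⧸ I := LinearMap.toSpanSingleton R (R ⧸ I) (I.mkQ a)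
  have ht : LinearMap.ker t ≠ ⊤ := by
    intro hk
    have h1 : (1 : R) ∈ LinearMap.ker t := by rw [hk]; trivial
    apply ha
    simpa [t] using h1
  obtain hm | ⟨m, hm, hle⟩ := IsCoatomic.eq_top_or_exists_le_coatom (LinearMap.ker t)
  · exact absurd hm ht
  have hs : IsSimpleModule R (R ⧸ m) := isSimpleModule_iff_isCoatom.2 hm
  have hinj := h (R ⧸ m) hs
  let i : (R ⧸ LinearMap.ker t) →ₗ[R] R ⧸ I := (LinearMap.ker t).liftQ t le_rfl
  have hi : Function.Injective i := by
    rw [← LinearMap.ker_eq_bot]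
    exact Submodule.ker_liftQ_eq_bot _ _ _ le_rfl
  obtain ⟨g, hg⟩ := hinj.out i hi ((LinearMap.ker t).liftQ m.mkQ (by simpa using hle))
  refine ⟨m, hm, g ∘ₗ I.mkQ, ?_, ?_⟩
  · intro x hx
    have : I.mkQ x = 0 := by simpa using hx
    rw [LinearMap.comp_apply, this, map_zero]
  · intro h0
    have h1 := hg ((LinearMap.ker t).mkQ 1)
    have h2 : i ((LinearMap.ker t).mkQ 1) = I.mkQ a := by
      change t 1 = _
      simp [t]
    rw [h2] at h1
    rw [LinearMap.comp_apply, h1] at h0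
    have h3 : (1 : R) ∈ m := by
      change m.mkQ 1 = 0 at h0
      simpa using h0
    exact hm.1 ((Ideal.eq_top_iff_one m).2 h3)

/-- If every semisimple `R`-module is injective, then `R` is Noetherian
and every simple `R`-module is injective (i.e. `R` is a V-ring). -/
theorem noetherian_VRing_of_semisimple_injective
    (R : Type u) [Ring R]
    (h : ∀ (M : Type u) [AddCommGroup M] [Module R M],
      IsSemisimpleModule R M → Module.Injective R M) :
    IsNoetherianRing R ∧
      ∀ (M : Type u) [AddCommGroup M] [Module R M],
        IsSimpleModule R M → Module.Injective R M := by
  have hV : ∀ (M : Type u) [AddCommGroup M] [Module R M],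
      IsSimpleModule R M → Module.Injective R M := fun M _ _ hM => h M inferInstance
  refine ⟨?_, hV⟩
  classical
  refine monotone_stabilizes_iff_noetherian.1 fun f => ?_
  by_contra hcon
  have hex : ∀ n, ∃ a, a ∈ (⨆ k, f k) ∧ a ∉ f n := by
    intro n
    by_contra hn
    push Not at hn
    exact hcon ⟨n, fun k hk => le_antisymm (f.mono hk) (fun x hx => hn x (le_iSup f k hx))⟩
  choose a haI haf using hex
  choose m hm g hg0 hga using fun n => exists_simple_sep R hV (f n) (a n) (haf n)
  have hss : ∀ n, IsSimpleModule R (R ⧸ m n) := fun n => isSimpleModule_iff_isCoatom.2 (hm n)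
  have hsem : IsSemisimpleModule R (Π₀ n, R ⧸ m n) := inferInstance
  have hinj : Module.Injective R (Π₀ n, R ⧸ m n) := h _ hsem
  have hmem : ∀ x : (⨆ k, f k : Submodule R R), ∃ k, ∀ n, k ≤ n → g n x = 0 := by
    intro x
    obtain ⟨k, hk⟩ := (Submodule.mem_iSup_of_directed f f.mono.directed_le).1 x.2
    exact ⟨k, fun n hn => hg0 n _ (f.mono hn hk)⟩
  choose K hK using hmem
  let φ (x : (⨆ k, f k : Submodule R R)) : Π₀ n, R ⧸ m n :=
    DFinsupp.mk (Finset.range (K x)) (fun n => g n x)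
  have hφ : ∀ x n, φ x n = g n x := by
    intro x n
    by_cases hn : n < K x
    · simp [φ, DFinsupp.mk_apply, hn]
    · simp [φ, DFinsupp.mk_apply, hn, hK x n (not_lt.1 hn)]
  let F : (⨆ k, f k : Submodule R R) →ₗ[R] Π₀ n, R ⧸ m n :=
    { toFun := φ
      map_add' := fun x y => by ext n; simp [hφ]
      map_smul' := fun r x => by
        ext n
        rw [DFinsupp.smul_apply, hφ, hφ, Submodule.coe_smul, map_smul, RingHom.id_apply] }
  obtain ⟨G, hG⟩ := hinj.out (⨆ k, f k : Submodule R R).subtype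
    (Submodule.injective_subtype _) F
  obtain ⟨n, hn⟩ := Infinite.exists_notMem_finset (G 1).support
  have h1 : G 1 n = 0 := by simpa using hn
  apply hga n
  have h2 : G (a n) = F ⟨a n, haI n⟩ := hG ⟨a n, haI n⟩
  have h3 : F ⟨a n, haI n⟩ n = g n (a n) := hφ _ n
  rw [← h3, ← h2]
  have h4 : G (a n) = a n • G 1 := by rw [← map_smul, smul_eq_mul, mul_one]
  rw [h4, DFinsupp.smul_apply, h1, smul_zero]
end

section
/- Let p be a prime number and consider the ℤ-modules X = (ℤ/pℤ) ⊕ (ℤ/p²ℤ)^(ℕ) and Y = (ℤ/pℤ)² ⊕ (ℤ/p²ℤ)^(ℕ), where (ℤ/p²ℤ)^(ℕ) denotes a countably infinite direct sum of copies of ℤ/p²ℤ. Then X is isomorphic to a submodule of Y and Y is isomorphic to a submodule of X, but X is not isomorphic to Y. -/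
open DirectSum

/-- `X = ℤ/pℤ ⊕ (ℤ/p²ℤ)^(ℕ)`, a countably infinite direct sum of copies of `ℤ/p²ℤ`
together with one copy of `ℤ/pℤ`, as a `ℤ`-module. -/
abbrev X18 (p : ℕ) : Type :=
  ZMod p × (⨁ _ : ℕ, ZMod (p ^ 2))

/-- `Y = (ℤ/pℤ)² ⊕ (ℤ/p²ℤ)^(ℕ)`. -/
abbrev Y18 (p : ℕ) : Type :=
  (ZMod p × ZMod p) × (⨁ _ : ℕ, ZMod (p ^ 2))

/-- Multiplication by `p` as an embedding of `ZMod p` into `ZMod (p ^ 2)`. -/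
theorem exists_emb18 (p : ℕ) (hp : p.Prime) :
    ∃ f : ZMod p →+ ZMod (p ^ 2), Function.Injective f := by
  have := Fact.mk hp
  have h0 : (zmultiplesHom (ZMod (p ^ 2)) (p : ZMod (p ^ 2))) (p : ℤ) = 0 := by
    have : ((p ^ 2 : ℕ) : ZMod (p ^ 2)) = 0 := ZMod.natCast_self _
    push_cast at this
    simp [← this, sq]
  refine ⟨ZMod.lift p ⟨zmultiplesHom (ZMod (p ^ 2)) (p : ZMod (p ^ 2)), h0⟩, ?_⟩
  rw [ZMod.lift_injective]
  intro m hm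
  have h1 : ((m * p : ℤ) : ZMod (p ^ 2)) = 0 := by
    simpa using hm
  rw [ZMod.intCast_zmod_eq_zero_iff_dvd] at h1
  rw [ZMod.intCast_zmod_eq_zero_iff_dvd]
  push_cast at h1
  rw [sq] at h1
  exact Int.dvd_of_mul_dvd_mul_right (by exact_mod_cast hp.ne_zero) h1

theorem div18 (p : ℕ) (hp : p.Prime) (z : ZMod (p ^ 2)) (hz : p • z = 0) :
    p • ((z.val / p : ℕ) : ZMod (p ^ 2)) = z := by
  have : NeZero (p ^ 2) := ⟨pow_ne_zero _ hp.ne_zero⟩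
  have h1 : ((p * z.val : ℕ) : ZMod (p ^ 2)) = 0 := by
    simpa using hz
  rw [ZMod.natCast_eq_zero_iff] at h1
  have h2 : p ∣ z.val := Nat.dvd_of_mul_dvd_mul_left hp.pos ((sq p).symm.dvd.trans h1)
  rw [nsmul_eq_mul, ← Nat.cast_mul, Nat.mul_div_cancel' h2]
  simp

theorem divD18 (p : ℕ) (hp : p.Prime) (v : ⨁ _ : ℕ, ZMod (p ^ 2)) (hv : p • v = 0) :
    ∃ w : ⨁ _ : ℕ, ZMod (p ^ 2), p • w = v := by
  refine ⟨DFinsupp.mapRange (fun _ z => ((z.val / p : ℕ) : ZMod (p ^ 2))) (by simp) v, ?_⟩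
  refine DFinsupp.ext fun i => ?_
  have h := DFunLike.congr_fun hv i
  exact div18 p hp (v i) h

theorem exists_shift18 (A : Type) [AddCommGroup A] :
    Nonempty ((⨁ _ : ℕ, A) ≃+ A × (⨁ _ : ℕ, A)) := by
  have e : ℕ ≃ Option ℕ := (Denumerable.eqv (Option ℕ)).symm
  exact ⟨(DirectSum.equivCongrLeft (β := fun _ => A) e).trans
    (DirectSum.addEquivProdDirectSum (α := fun _ : Option ℕ => A))⟩

/-- `X` embeds in `Y` and `Y` embeds in `X` as `ℤ`-modules, but
`X` is not isomorphic to `Y`. -/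
theorem X18_Y18_subisomorphic_not_isomorphic (p : ℕ) (hp : p.Prime) :
    (∃ f : X18 p →ₗ[ℤ] Y18 p, Function.Injective f) ∧
    (∃ g : Y18 p →ₗ[ℤ] X18 p, Function.Injective g) ∧
    ¬ Nonempty (X18 p ≃ₗ[ℤ] Y18 p) := by
  refine ⟨?_, ?_, ?_⟩
  · refine ⟨((AddMonoidHom.inl (ZMod p) (ZMod p)).prodMap
      (AddMonoidHom.id (⨁ _ : ℕ, ZMod (p ^ 2)))).toIntLinearMap, ?_⟩
    rintro ⟨a, v⟩ ⟨b, w⟩ h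
    simpa using h
  · obtain ⟨f, hf⟩ := exists_emb18 p hp
    obtain ⟨e⟩ := exists_shift18 (ZMod (p ^ 2))
    let g : Y18 p →+ X18 p :=
      { toFun := fun y => (y.1.1, e.symm (f y.1.2, y.2))
        map_zero' := by
          have : e.symm ((0 : ZMod (p ^ 2)), (0 : ⨁ _ : ℕ, ZMod (p ^ 2))) = 0 := e.symm.map_zero
          simp [this]
        map_add' := fun x y => by
          simp [← map_add] }
    refine ⟨g.toIntLinearMap, ?_⟩
    rintro ⟨⟨a, b⟩, v⟩ ⟨⟨c, d⟩, w⟩ h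
    have h' : (a, e.symm (f b, v)) = (c, e.symm (f d, w)) := h
    simp only [Prod.mk.injEq, EmbeddingLike.apply_eq_iff_eq] at h'
    obtain ⟨h1, h2, h3⟩ := h'
    rw [h1, hf h2, h3]
  · rintro ⟨e⟩
    have := Fact.mk hp
    have hpz : ∀ a : ZMod p, p • a = 0 := fun a => by simp
    have hni : ¬ Function.Injective
        (fun ab : ZMod p × ZMod p => (e.symm (ab, 0)).1) := by
      intro h
      have := Fintype.card_le_of_injective _ h
      rw [Fintype.card_prod, ZMod.card] at this
      nlinarith [hp.two_le]
    apply hni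
    intro a b hab
    have hab' : (e.symm (a, 0)).1 = (e.symm (b, 0)).1 := hab
    have hd : (e.symm (a - b, 0)).1 = 0 := by
      have : ((a - b, 0) : Y18 p) = (a, 0) - (b, 0) := by simp
      rw [this, map_sub, Prod.fst_sub, hab', sub_self]
    have hk : p • ((a - b, 0) : Y18 p) = 0 := by
      ext1
      · ext1 <;> exact hpz _
      · exact smul_zero _
    have hk2 : p • e.symm (a - b, 0) = 0 := by
      rw [← map_nsmul, hk, map_zero]
    obtain ⟨w, hw⟩ := divD18 p hp (e.symm (a - b, 0)).2 (congrArg Prod.snd hk2)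
    have hx : e.symm (a - b, 0) = p • ((0, w) : X18 p) := by
      ext1
      · rw [hd]; exact (hpz 0).symm
      · exact hw.symm
    have hy : ((a - b, 0) : Y18 p) = p • e (0, w) := by
      rw [← map_nsmul, ← hx, LinearEquiv.apply_symm_apply]
    have h1 : a - b = p • (e (0, w)).1 := congrArg Prod.fst hy
    have h2 : p • (e (0, w)).1 = 0 := by
      ext1 <;> exact hpz _
    exact sub_eq_zero.mp (h1.trans h2)
end

section
/- Let p be a prime number and consider the ℤ-modules X = ℚ^(ℕ) (a countably infinite direct product of copies of ℚ) and Y = ℚ^(ℕ) ⊕ ℤ(p^∞), where ℤ(p^∞) is the Prüfer p-group (the p-primary torsion subgroup of ℚ/ℤ). Then there exist a surjective ℤ-module homomorphism from X onto Y and a surjective ℤ-module homomorphism from Y onto X, but X is not isomorphic to Y. -/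
/-- `ℚ/ℤ` as a `ℤ`-module. -/
abbrev QModZ : Type := ℚ ⧸ (Submodule.span ℤ {(1 : ℚ)})

/-- The Prüfer `p`-group `ℤ(p^∞)`: the subgroup of `ℚ/ℤ` consisting of the elements
annihilated by some power of `p`. -/
def pruferGroup (p : ℕ) : Submodule ℤ QModZ where
  carrier := {x | ∃ n : ℕ, ((p : ℤ) ^ n) • x = 0}
  zero_mem' := ⟨0, smul_zero _⟩
  add_mem' := by
    rintro a b ⟨n, hn⟩ ⟨m, hm⟩
    refine ⟨n + m, ?_⟩
    have ha : ((p : ℤ) ^ (n + m)) • a = 0 := by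
      rw [pow_add, mul_comm, mul_smul, hn, smul_zero]
    have hb : ((p : ℤ) ^ (n + m)) • b = 0 := by
      rw [pow_add, mul_smul, hm, smul_zero]
    rw [smul_add, ha, hb, add_zero]
  smul_mem' := by
    rintro c x ⟨n, hn⟩
    exact ⟨n, by rw [smul_comm, hn, smul_zero]⟩

lemma prufer_divisible (p : ℕ) (hp : p.Prime) (n : ℤ) (hn : n ≠ 0) (x : pruferGroup p) :
    ∃ y : pruferGroup p, n • y = x := by
  obtain ⟨x, k, hk⟩ := x
  obtain ⟨a, rfl⟩ := Submodule.mkQ_surjective _ x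
  have hfin : FiniteMultiplicity (p : ℤ) n :=
    Int.finiteMultiplicity_iff.2 ⟨by simpa using hp.ne_one, hn⟩
  obtain ⟨m, hm, hpm⟩ := hfin.exists_eq_pow_mul_and_not_dvd
  generalize multiplicity (p : ℤ) n = j at hm
  have hpp : Prime (p : ℤ) := Nat.prime_iff_prime_int.1 hp
  have hc : IsCoprime ((p : ℤ) ^ k) m :=
    IsCoprime.pow_left ((hpp.irreducible.coprime_iff_not_dvd).2 hpm)
  obtain ⟨v, u, huv⟩ := hc
  obtain ⟨y, hy⟩ : ∃ y : QModZ, n • y = Submodule.mkQ (Submodule.span ℤ {(1 : ℚ)}) a := by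
    refine ⟨Submodule.mkQ _ (a / n), ?_⟩
    rw [← map_smul]
    congr 1
    have : (n : ℚ) ≠ 0 := by exact_mod_cast hn
    rw [zsmul_eq_mul]
    field_simp
  rw [← hy] at hk
  have hx : (u * m) • (n • y) = n • y := by
    have h1 : (u * m) = 1 - v * (p : ℤ) ^ k := by linarith
    rw [h1, sub_smul, one_smul, mul_smul, hk, smul_zero, sub_zero]
  refine ⟨⟨(u * m) • y, k + j, ?_⟩, ?_⟩
  · have h2 : (p : ℤ) ^ (k + j) * (u * m) = u * ((p : ℤ) ^ k * n) := by
      rw [hm]; ring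
    rw [← mul_smul, h2, mul_smul, mul_smul, hk, smul_zero]
  · apply Subtype.ext
    change n • ((u * m) • y) = _
    rw [smul_comm, hx, hy]

lemma exists_rat_onto_prufer (p : ℕ) (hp : p.Prime) :
    ∃ q : ℚ →ₗ[ℤ] pruferGroup p, Function.Surjective q := by
  classical
  choose d hd using prufer_divisible p hp
  letI : DivisibleBy (pruferGroup p) ℤ :=
    { div := fun a n => if h : n = 0 then 0 else d n h a
      div_zero := fun a => by simp
      div_cancel := fun {n} a h => by
        rw [dif_neg h]
        exact hd n h a }
  obtain ⟨r, hr⟩ := (Module.Baer.of_divisible (pruferGroup p)).extension_property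
    (pruferGroup p).subtype (pruferGroup p).injective_subtype LinearMap.id
  refine ⟨r ∘ₗ Submodule.mkQ _, fun x => ?_⟩
  obtain ⟨a, ha⟩ := Submodule.mkQ_surjective (Submodule.span ℤ {(1 : ℚ)}) x.1
  refine ⟨a, ?_⟩
  rw [LinearMap.comp_apply, ha]
  exact LinearMap.congr_fun hr x

lemma exists_prufer_torsion (p : ℕ) (hp : p.Prime) :
    ∃ x : pruferGroup p, x ≠ 0 ∧ (p : ℤ) • x = 0 := by
  have hp0 : (p : ℚ) ≠ 0 := by exact_mod_cast hp.ne_zero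
  have hz : (p : ℤ) • Submodule.mkQ (Submodule.span ℤ {(1 : ℚ)}) (1 / p) = 0 := by
    rw [← map_smul, Submodule.mkQ_apply, Submodule.Quotient.mk_eq_zero]
    rw [Submodule.mem_span_singleton]
    refine ⟨1, ?_⟩
    rw [zsmul_eq_mul, zsmul_eq_mul]
    push_cast
    field_simp
  refine ⟨⟨Submodule.mkQ _ (1 / p), 1, by rw [pow_one]; exact hz⟩, ?_, Subtype.ext hz⟩
  intro h
  have h := congrArg Subtype.val h
  change Submodule.mkQ _ (1 / (p : ℚ)) = 0 at h
  rw [Submodule.mkQ_apply, Submodule.Quotient.mk_eq_zero, Submodule.mem_span_singleton] at h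
  obtain ⟨a, ha⟩ := h
  rw [zsmul_eq_mul, mul_one, eq_div_iff hp0] at ha
  have ha' : a * (p : ℤ) = 1 := by exact_mod_cast ha
  have : (p : ℤ) ∣ 1 := ⟨a, by rw [mul_comm]; exact ha'.symm⟩
  exact (Nat.prime_iff_prime_int.1 hp).not_dvd_one this

/-- With `X = ℚ^ℕ` (a countably infinite direct product of copies of `ℚ`)
and `Y = ℚ^ℕ ⊕ ℤ(p^∞)`, there are surjective `ℤ`-module homomorphisms `X → Y` and
`Y → X`, but `X` is not isomorphic to `Y`. -/
theorem prod_rat_prufer_epis_not_isomorphic (p : ℕ) (hp : p.Prime) :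
    (∃ f : (ℕ → ℚ) →ₗ[ℤ] ((ℕ → ℚ) × pruferGroup p), Function.Surjective f) ∧
    (∃ g : ((ℕ → ℚ) × pruferGroup p) →ₗ[ℤ] (ℕ → ℚ), Function.Surjective g) ∧
    ¬ Nonempty ((ℕ → ℚ) ≃ₗ[ℤ] ((ℕ → ℚ) × pruferGroup p)) := by
  refine ⟨?_, ⟨LinearMap.fst ℤ _ _, LinearMap.fst_surjective⟩, ?_⟩
  · obtain ⟨q, hq⟩ := exists_rat_onto_prufer p hp
    refine ⟨LinearMap.prod (LinearMap.funLeft ℤ ℚ Nat.succ) (q ∘ₗ LinearMap.proj 0), ?_⟩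
    rintro ⟨w, x⟩
    obtain ⟨a, rfl⟩ := hq x
    exact ⟨fun n => Nat.casesOn n a w, rfl⟩
  · rintro ⟨e⟩
    obtain ⟨x, hx0, hx⟩ := exists_prufer_torsion p hp
    have h1 : (p : ℤ) • e.symm (0, x) = 0 := by
      rw [← map_smul, Prod.smul_mk, hx, smul_zero]
      exact map_zero e.symm
    have hpz : (p : ℤ) ≠ 0 := by exact_mod_cast hp.ne_zero
    have h2 : e.symm (0, x) = 0 := (smul_eq_zero.1 h1).resolve_left hpz
    have h3 := (LinearEquiv.map_eq_zero_iff e.symm).1 h2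
    exact hx0 (congrArg Prod.snd h3)
end
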